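/- arXiv:2109.00021 — 2 statements merged into one kernel-verified Lean document; each statement's English description precedes it below -/
import Mathlib

section
/- Small energy majorization on the bi-tree fails with any rate whatsoever: for every function h : (0,∞) → (0,∞) with h(t) → 0 as t → 0⁺ and every constant C > 0, there exist an integer N ≥ 1, functions f, g : T² → [0,∞) on the bi-tree T² of depth N with g superadditive in each variable, and numbers δ > 0 and λ ≥ 10δ, such that f is supported in {α : 𝕀g(α) ≤ δ}, and yet no function φ : T² → [0,∞) satisfies both 𝕀φ ≥ 𝕀f on {α : 2λ ≤ 𝕀g(α) ≤ 4λ} and ∑_{α∈T²} φ(α)² ≤ C·h(δ/λ)·∑_{α∈T²} f(α)². -/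
open Finset

def strings : ℕ → Finset (List Bool)
  | 0 => {([] : List Bool)}
  | N + 1 =>
      {([] : List Bool)} ∪ (strings N).image (List.cons true) ∪ (strings N).image (List.cons false)

/-- Vertices of the bi-tree `T²` of depth `N`: pairs of binary strings of length at most `N`,
ordered by `(α,β) ≤ (α',β')` iff `α' <+: α` and `β' <+: β`. -/
def biVertices (N : ℕ) : Finset (List Bool × List Bool) := strings N ×ˢ strings N

/-- `𝕀 f (p) = ∑_{p' ≥ p} f p'`. -/
noncomputable def biI (N : ℕ) (f : List Bool × List Bool → ℝ) (p : List Bool × List Bool) : ℝ :=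
  ∑ q ∈ (biVertices N).filter (fun q => q.1 <+: p.1 ∧ q.2 <+: p.2), f q

/-- `𝕀* f (p) = ∑_{p' ≤ p} f p'`. -/
noncomputable def biIstar (N : ℕ) (f : List Bool × List Bool → ℝ) (p : List Bool × List Bool) : ℝ :=
  ∑ q ∈ (biVertices N).filter (fun q => p.1 <+: q.1 ∧ p.2 <+: q.2), f q

/-- The potential `V^μ = 𝕀 (𝕀* μ)` on the bi-tree. -/
noncomputable def biV (N : ℕ) (μ : List Bool × List Bool → ℝ) : List Bool × List Bool → ℝ :=
  biI N (biIstar N μ)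

/-- The total mass `|μ|`. -/
noncomputable def biMass (N : ℕ) (μ : List Bool × List Bool → ℝ) : ℝ :=
  ∑ p ∈ biVertices N, μ p

/-- A measure on the boundary `∂T²`: a nonnegative function vanishing off pairs of strings
both of length exactly `N`. -/
def IsBiMeasureOnBoundary (N : ℕ) (μ : List Bool × List Bool → ℝ) : Prop :=
  (∀ p, 0 ≤ μ p) ∧ ∀ p, μ p ≠ 0 → p.1.length = N ∧ p.2.length = N

/-- The energy `E[ν] = ∑_{α∈T²} (𝕀*ν(α))²`. -/
noncomputable def biEnergy (N : ℕ) (ν : List Bool × List Bool → ℝ) : ℝ :=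
  ∑ p ∈ biVertices N, (biIstar N ν p) ^ 2

/-- The partial energy `E_ε[ν] = ∑_{α∈T² : V^ν(α) ≤ ε} (𝕀*ν(α))²`. -/
noncomputable def biPartialEnergy (N : ℕ) (ν : List Bool × List Bool → ℝ) (ε : ℝ) : ℝ :=
  ∑ p ∈ (biVertices N).filter (fun p => biV N ν p ≤ ε), (biIstar N ν p) ^ 2

/-- `cap(E) = inf { ∑ f² : f ≥ 0, 𝕀f ≥ 1 on E }` on the bi-tree of depth `N`. -/
noncomputable def biCap (N : ℕ) (E : Set (List Bool × List Bool)) : ℝ :=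
  sInf { t : ℝ | ∃ f : List Bool × List Bool → ℝ, (∀ p, 0 ≤ f p) ∧
    (∀ p ∈ E, 1 ≤ biI N f p) ∧ t = ∑ p ∈ biVertices N, (f p) ^ 2 }

/-- Superadditivity in each variable on the bi-tree of depth `N`. -/
def BiSuperadditive (N : ℕ) (g : List Bool × List Bool → ℝ) : Prop :=
  (∀ α β : List Bool, α.length < N → β.length ≤ N →
    g (α ++ [false], β) + g (α ++ [true], β) ≤ g (α, β)) ∧
  (∀ α β : List Bool, α.length ≤ N → β.length < N →
    g (α, β ++ [false]) + g (α, β ++ [true]) ≤ g (α, β))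

theorem mem_strings {N : ℕ} {u : List Bool} : u ∈ strings N ↔ u.length ≤ N := by
  induction N generalizing u with
  | zero => simp [strings]
  | succ N ih =>
    cases u with
    | nil => simp [strings]
    | cons b u => cases b <;> simp [strings, ih]

theorem sum_prefix (N : ℕ) (F : List Bool → ℝ) {x : List Bool} (hx : x.length ≤ N) :
    ∑ u ∈ (strings N).filter (fun u => u <+: x), F u
      = ∑ s ∈ range (x.length + 1), F (x.take s) := by
  have himage : (strings N).filter (fun u => u <+: x)
      = (range (x.length + 1)).image (fun s => x.take s) := by
    ext u
    simp only [mem_filter, mem_strings, mem_image, mem_range]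
    constructor
    · rintro ⟨-, hu⟩
      exact ⟨u.length, Nat.lt_succ_of_le hu.length_le, (List.prefix_iff_eq_take.1 hu).symm⟩
    · rintro ⟨s, -, rfl⟩
      exact ⟨(List.length_take_le' _ _).trans hx, List.take_prefix _ _⟩
  rw [himage, sum_image]
  intro s hs t ht hst
  have hlen := congrArg List.length hst
  simp only [coe_range, Set.mem_Iio] at hs ht
  simp only [List.length_take] at hlen
  omega

theorem biI_eq_sum_take (N : ℕ) (F : List Bool × List Bool → ℝ) {x y : List Bool}
    (hx : x.length ≤ N) (hy : y.length ≤ N) :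
    biI N F (x, y) = ∑ s ∈ range (x.length + 1), ∑ t ∈ range (y.length + 1),
      F (x.take s, y.take t) := by
  rw [biI, biVertices, filter_product (fun u => u <+: x) (fun v => v <+: y), sum_product,
    ← sum_prefix N (fun u => ∑ t ∈ range (y.length + 1), F (u, y.take t)) hx]
  exact sum_congr rfl fun u _ => sum_prefix N (fun v => F (u, v)) hy

theorem biI_root_indicator (N : ℕ) (p : List Bool × List Bool) :
    biI N (fun q => if q = ([], []) then 1 else 0) p = 1 := by
  rw [biI, sum_ite_eq']
  simp [biVertices, mem_strings]

/-- The number of indices `i ∈ s` such that `p` lies above `Q i`. -/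
noncomputable def countBelow {ι : Type*} (s : Finset ι) (Q : ι → List Bool × List Bool)
    (p : List Bool × List Bool) : ℝ :=
  ∑ i ∈ s, if p.1 <+: (Q i).1 ∧ p.2 <+: (Q i).2 then 1 else 0

theorem sum_biI_eq_sum_mul_countBelow {ι : Type*} (N : ℕ) (s : Finset ι)
    (Q : ι → List Bool × List Bool) (F : List Bool × List Bool → ℝ) :
    ∑ i ∈ s, biI N F (Q i) = ∑ p ∈ biVertices N, F p * countBelow s Q p := by
  simp only [biI, countBelow, sum_filter, mul_sum, mul_ite, mul_one, mul_zero]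
  exact sum_comm

/-- If the potential generated by the points `Q i` is at most `K` at each of these points, then
every `F` with `𝕀F ≥ 1` at these points has energy at least `#s / K`. -/
theorem card_le_mul_sum_sq {ι : Type*} (N : ℕ) {s : Finset ι} (hs : s.Nonempty)
    {Q : ι → List Bool × List Bool} {F : List Bool × List Bool → ℝ} {K : ℝ}
    (hK : ∀ i ∈ s, biI N (countBelow s Q) (Q i) ≤ K) (hF : ∀ i ∈ s, 1 ≤ biI N F (Q i)) :
    (#s : ℝ) ≤ K * ∑ p ∈ biVertices N, F p ^ 2 := by
  have hcard : (0 : ℝ) < #s := by exact_mod_cast hs.card_pos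
  have hlower : (#s : ℝ) ≤ ∑ p ∈ biVertices N, F p * countBelow s Q p := by
    rw [← sum_biI_eq_sum_mul_countBelow]
    simpa using card_nsmul_le_sum s _ 1 hF
  have hupper : ∑ p ∈ biVertices N, countBelow s Q p ^ 2 ≤ #s * K := by
    simp only [sq]
    rw [← sum_biI_eq_sum_mul_countBelow]
    simpa using sum_le_card_nsmul s _ K hK
  have hcs := sum_mul_sq_le_sq_mul_sq (biVertices N) F (countBelow s Q)
  have hnonneg : 0 ≤ ∑ p ∈ biVertices N, F p ^ 2 := sum_nonneg fun _ _ => sq_nonneg _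
  have hsq : (#s : ℝ) * #s ≤ #s * (K * ∑ p ∈ biVertices N, F p ^ 2) := by
    calc (#s : ℝ) * #s ≤ (∑ p ∈ biVertices N, F p * countBelow s Q p) ^ 2 := by
          rw [sq]; exact mul_self_le_mul_self hcard.le hlower
      _ ≤ _ := hcs
      _ ≤ (∑ p ∈ biVertices N, F p ^ 2) * (#s * K) := by gcongr
      _ = _ := by ring
  exact le_of_mul_le_mul_left hsq hcard

/-- The word `w` followed by `T` zeros. -/
def paddedWord {n : ℕ} (T : ℕ) (w : List.Vector Bool n) : List Bool :=
  w.toList ++ List.replicate T false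

theorem length_paddedWord {n : ℕ} (T : ℕ) (w : List.Vector Bool n) :
    (paddedWord T w).length = n + T := by
  simp [paddedWord]

theorem card_prefix_paddedWord_le (n T : ℕ) (u : List Bool) :
    #{w : List.Vector Bool n | u <+: paddedWord T w} ≤ 2 ^ (n - u.length) := by
  have hcard : #(univ : Finset (List.Vector Bool (n - u.length))) = 2 ^ (n - u.length) := by
    rw [card_univ, card_vector, Fintype.card_bool]
  rw [← hcard]
  refine card_le_card_of_injOn (fun w => ⟨w.toList.drop u.length, by simp⟩)
    (fun _ _ => mem_coe.2 (mem_univ _)) ?_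
  have htake : ∀ w : List.Vector Bool n, u <+: paddedWord T w →
      w.toList.take u.length = u.take n := by
    intro w hw
    rw [List.prefix_iff_eq_take] at hw
    conv_rhs => rw [hw]
    rw [List.take_take, paddedWord, List.take_append_of_le_length (by simp)]
    rcases le_total n u.length with h | h
    · rw [min_eq_left h, List.take_of_length_le (by simpa using h),
        List.take_of_length_le (by simp)]
    · rw [min_eq_right h]
  intro w hw w' hw' hww'
  simp only [coe_filter, mem_univ, true_and, Set.mem_ofPred_eq] at hw hw'
  apply List.Vector.toList_injective
  rw [← List.take_append_drop u.length w.toList, ← List.take_append_drop u.length w'.toList,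
    htake w hw, htake w' hw']
  exact congrArg (u.take n ++ ·) (congrArg Subtype.val hww')

theorem two_pow_sub_le (n m : ℕ) : (2 : ℝ) ^ (n - m) ≤ 1 + 2 ^ n * (1 / 2) ^ m := by
  rcases le_total n m with h | h
  · rw [Nat.sub_eq_zero_of_le h, pow_zero]
    exact le_add_of_nonneg_right (by positivity)
  · obtain ⟨k, rfl⟩ := Nat.exists_eq_add_of_le h
    have hk : (2 : ℝ) ^ (m + k) * (1 / 2) ^ m = 2 ^ k := by
      rw [pow_add, mul_right_comm, ← mul_pow]; norm_num
    rw [hk, Nat.add_sub_cancel_left]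
    linarith

/-- The number of words whose padding starts with both `u` and `v`. -/
noncomputable def wordCount (n T : ℕ) (p : List Bool × List Bool) : ℝ :=
  countBelow univ (fun w : List.Vector Bool n => (paddedWord T w, paddedWord T w)) p

theorem wordCount_eq_card (n T : ℕ) (p : List Bool × List Bool) :
    wordCount n T p
      = #{w : List.Vector Bool n | p.1 <+: paddedWord T w ∧ p.2 <+: paddedWord T w} := by
  simp [wordCount, countBelow]

theorem half_pow_le_of_le {s t : ℕ} (h : s ≤ t) :
    (1 / 2 : ℝ) ^ t ≤ (3 / 4) ^ s * (3 / 4) ^ t := by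
  obtain ⟨k, rfl⟩ := Nat.exists_eq_add_of_le h
  calc (1 / 2 : ℝ) ^ (s + k) = (1 / 2) ^ s * (1 / 2) ^ k := pow_add _ _ _
    _ ≤ (9 / 16) ^ s * (3 / 4) ^ k := by
      gcongr ?_ ^ s * ?_ ^ k <;> norm_num
    _ = (3 / 4) ^ s * (3 / 4) ^ (s + k) := by
      rw [pow_add, ← mul_assoc, ← mul_pow]; norm_num

theorem wordCount_le (n T : ℕ) (u v : List Bool) :
    wordCount n T (u, v) ≤ 1 + 2 ^ n * ((3 / 4) ^ u.length * (3 / 4) ^ v.length) := by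
  have hbound : ∀ z : List Bool, (∀ w : List.Vector Bool n,
      u <+: paddedWord T w ∧ v <+: paddedWord T w → z <+: paddedWord T w) →
      wordCount n T (u, v) ≤ 1 + 2 ^ n * (1 / 2) ^ z.length := by
    intro z hz
    refine le_trans ?_ (two_pow_sub_le n z.length)
    rw [wordCount_eq_card]
    exact_mod_cast (card_le_card (monotone_filter_right _ fun w _ => hz w)).trans
      (card_prefix_paddedWord_le n T z)
  rcases le_total u.length v.length with h | h
  · refine (hbound v fun _ hw => hw.2).trans ?_
    gcongr
    exact half_pow_le_of_le h
  · refine (hbound u fun _ hw => hw.1).trans ?_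
    rw [mul_comm ((3 / 4 : ℝ) ^ u.length)]
    gcongr
    exact half_pow_le_of_le h

theorem one_le_wordCount_take {n : ℕ} (T : ℕ) (w : List.Vector Bool n) (s t : ℕ) :
    1 ≤ wordCount n T ((paddedWord T w).take s, (paddedWord T w).take t) := by
  rw [wordCount_eq_card]
  exact_mod_cast card_pos.2 ⟨w, by simp [List.take_prefix]⟩

theorem card_filter_append_le {ι : Type*} (s : Finset ι) (x : ι → List Bool) (P : ι → Prop)
    [DecidablePred P] (α : List Bool) :
    #{i ∈ s | α ++ [false] <+: x i ∧ P i} + #{i ∈ s | α ++ [true] <+: x i ∧ P i}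
      ≤ #{i ∈ s | α <+: x i ∧ P i} := by
  classical
  rw [← card_union_of_disjoint]
  · refine card_le_card ?_
    intro i
    simp only [mem_union, mem_filter]
    rintro (⟨hi, h, hP⟩ | ⟨hi, h, hP⟩) <;>
      exact ⟨hi, (List.prefix_append _ _).trans h, hP⟩
  · refine disjoint_filter.2 fun i _ h h' => ?_
    have heq := (List.prefix_of_prefix_length_le h.1 h'.1 (by simp)).eq_of_length (by simp)
    simp at heq

theorem biSuperadditive_wordCount (N n T : ℕ) : BiSuperadditive N (wordCount n T) := by
  constructor
  · intro α β _ _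
    simp only [wordCount_eq_card]
    exact_mod_cast card_filter_append_le univ (paddedWord T) (fun w => β <+: paddedWord T w) α
  · intro α β _ _
    simp only [wordCount_eq_card, and_comm (a := α <+: _)]
    exact_mod_cast card_filter_append_le univ (paddedWord T) (fun w => α <+: paddedWord T w) β

/-- The vertex above `(paddedWord T w, paddedWord T w)` having `2 ^ a * 2 ^ b` ancestors. -/
def corner {n : ℕ} (T : ℕ) (w : List.Vector Bool n) (a b : ℕ) : List Bool × List Bool :=
  ((paddedWord T w).take (2 ^ a - 1), (paddedWord T w).take (2 ^ b - 1))

theorem length_take_paddedWord {n T s : ℕ} (w : List.Vector Bool n) (hs : s ≤ T) :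
    ((paddedWord T w).take s).length = s := by
  rw [List.length_take, length_paddedWord]; omega

theorem biI_corner {n T a b : ℕ} (w : List.Vector Bool n) (ha : 2 ^ a ≤ T) (hb : 2 ^ b ≤ T)
    (F : List Bool × List Bool → ℝ) :
    biI T F (corner T w a b) = ∑ s ∈ range (2 ^ a), ∑ t ∈ range (2 ^ b),
      F ((paddedWord T w).take s, (paddedWord T w).take t) := by
  have ha' := Nat.one_le_two_pow (n := a)
  have hb' := Nat.one_le_two_pow (n := b)
  have hla := length_take_paddedWord (T := T) (s := 2 ^ a - 1) w (by omega)
  have hlb := length_take_paddedWord (T := T) (s := 2 ^ b - 1) w (by omega)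
  rw [corner, biI_eq_sum_take T F (by omega) (by omega), hla, hlb, Nat.sub_add_cancel ha',
    Nat.sub_add_cancel hb']
  refine sum_congr rfl fun s hs => sum_congr rfl fun t ht => ?_
  rw [mem_range] at hs ht
  rw [List.take_take, List.take_take, min_eq_left (by omega), min_eq_left (by omega)]

theorem sum_three_quarters_pow_le (k : ℕ) : ∑ s ∈ range k, (3 / 4 : ℝ) ^ s ≤ 4 := by
  have h := geom_sum_eq (by norm_num : (3 / 4 : ℝ) ≠ 1) k
  have hk : (0 : ℝ) ≤ (3 / 4) ^ k := by positivity
  rw [h, div_le_iff_of_neg (by norm_num)]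
  linarith

theorem sum_box_le (A B : ℕ) (c : ℝ) (hc : 0 ≤ c) :
    ∑ s ∈ range A, ∑ t ∈ range B, (1 + c * ((3 / 4 : ℝ) ^ s * (3 / 4) ^ t)) ≤ A * B + 16 * c := by
  simp only [sum_add_distrib, ← mul_sum, ← sum_mul, sum_const, card_range, nsmul_eq_mul, mul_one]
  have h : (∑ s ∈ range A, (3 / 4 : ℝ) ^ s) * ∑ t ∈ range B, (3 / 4 : ℝ) ^ t ≤ 4 * 4 :=
    mul_le_mul (sum_three_quarters_pow_le A) (sum_three_quarters_pow_le B)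
      (sum_nonneg fun _ _ => by positivity) (by norm_num)
  nlinarith

theorem biI_wordCount_corner_bounds {n T a b : ℕ} (w : List.Vector Bool n) (ha : 2 ^ a ≤ T)
    (hb : 2 ^ b ≤ T) :
    (2 : ℝ) ^ (a + b) ≤ biI T (wordCount n T) (corner T w a b) ∧
      biI T (wordCount n T) (corner T w a b) ≤ 2 ^ (a + b) + 16 * 2 ^ n := by
  rw [biI_corner w ha hb]
  constructor
  · calc (2 : ℝ) ^ (a + b) = ∑ _s ∈ range (2 ^ a), ∑ _t ∈ range (2 ^ b), (1 : ℝ) := by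
          simp [pow_add]
      _ ≤ _ := sum_le_sum fun s _ => sum_le_sum fun t _ => one_le_wordCount_take T w s t
  · refine le_trans (sum_le_sum fun s hs => sum_le_sum fun t ht => ?_)
      ((sum_box_le (2 ^ a) (2 ^ b) (2 ^ n) (by positivity)).trans ?_)
    · rw [mem_range] at hs ht
      refine (wordCount_le _ _ _ _).trans_eq ?_
      rw [length_take_paddedWord w (by omega), length_take_paddedWord w (by omega)]
    · push_cast
      rw [pow_add]

theorem sum_half_pow_dist_le (L j : ℕ) :
    ∑ i ∈ range L, (1 / 2 : ℝ) ^ (i - j + (j - i)) ≤ 4 := by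
  have hgeom : ∀ k, ∑ i ∈ range k, (1 / 2 : ℝ) ^ i ≤ 2 := fun k => by
    simpa using sum_geometric_two_le k
  calc ∑ i ∈ range L, (1 / 2 : ℝ) ^ (i - j + (j - i))
      ≤ ∑ i ∈ range (j + L), (1 / 2 : ℝ) ^ (i - j + (j - i)) :=
        sum_le_sum_of_subset_of_nonneg (range_mono (Nat.le_add_left _ _))
          fun _ _ _ => by positivity
    _ = ∑ i ∈ range j, (1 / 2 : ℝ) ^ (i - j + (j - i)) + ∑ i ∈ range L, (1 / 2 : ℝ) ^ i := by
        rw [sum_range_add]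
        congr 1
        exact sum_congr rfl fun i _ => by congr 1; omega
    _ ≤ ∑ i ∈ range j, (1 / 2 : ℝ) ^ i + ∑ i ∈ range L, (1 / 2 : ℝ) ^ i := by
        gcongr ?_ + _
        rw [← sum_range_reflect (fun i => (1 / 2 : ℝ) ^ i)]
        refine sum_le_sum fun i hi => ?_
        rw [mem_range] at hi
        exact pow_le_pow_of_le_one (by norm_num) (by norm_num) (by omega)
    _ ≤ 4 := by linarith [hgeom j, hgeom L]

/-- Along a hyperbola of corners, the boxes of ancestors overlap geometrically little. -/
theorem min_mul_min_le {m i j : ℕ} (hi : i ≤ m) (hj : j ≤ m) :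
    ((min (2 ^ i) (2 ^ j) * min (2 ^ (m - i)) (2 ^ (m - j)) : ℕ) : ℝ)
      ≤ 2 ^ m * (1 / 2) ^ (i - j + (j - i)) := by
  wlog h : i ≤ j generalizing i j
  · rw [min_comm, min_comm (2 ^ (m - i)), add_comm (i - j)]
    exact this hj hi (le_of_not_ge h)
  obtain ⟨k, rfl⟩ := Nat.exists_eq_add_of_le h
  obtain ⟨r, rfl⟩ := Nat.exists_eq_add_of_le hj
  have heq : (2 : ℝ) ^ (i + k + r) * (1 / 2) ^ (i - (i + k) + (i + k - i))
      = ((2 ^ i * 2 ^ (i + k + r - (i + k)) : ℕ) : ℝ) := by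
    rw [show i - (i + k) + (i + k - i) = k by omega, show i + k + r - (i + k) = r by omega,
      one_div, inv_pow]
    push_cast
    field_simp
    ring
  rw [heq]
  exact_mod_cast Nat.mul_le_mul (min_le_left _ _) (min_le_right _ _)

theorem countBelow_corner_le {n T L : ℕ} (a b : ℕ → ℕ) (w : List.Vector Bool n) {s t : ℕ}
    (hs : s ≤ T) (ht : t ≤ T) :
    countBelow (univ ×ˢ range L)
        (fun i : List.Vector Bool n × ℕ => corner T i.1 (a i.2) (b i.2))
        ((paddedWord T w).take s, (paddedWord T w).take t)
      ≤ ∑ j ∈ range L, if s < 2 ^ a j ∧ t < 2 ^ b j then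
          1 + 2 ^ n * ((3 / 4 : ℝ) ^ s * (3 / 4) ^ t) else 0 := by
  rw [countBelow, sum_product_right]
  refine sum_le_sum fun j _ => ?_
  have hlt : ∀ (w' : List.Vector Bool n) (r k : ℕ), r ≤ T →
      (paddedWord T w).take r <+: (paddedWord T w').take (2 ^ k - 1) →
      r < 2 ^ k ∧ (paddedWord T w).take r <+: paddedWord T w' := by
    intro w' r k hr h
    refine ⟨?_, h.trans (List.take_prefix _ _)⟩
    have hlen := h.length_le
    rw [length_take_paddedWord w hr, List.length_take] at hlen
    have := Nat.one_le_two_pow (n := k)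
    omega
  split_ifs with hst
  · have hle := wordCount_le n T ((paddedWord T w).take s) ((paddedWord T w).take t)
    rw [length_take_paddedWord w hs, length_take_paddedWord w ht] at hle
    refine le_trans ?_ hle
    rw [wordCount, countBelow]
    refine sum_le_sum fun w' _ => ?_
    split_ifs with h1 h2
    · exact le_rfl
    · exact absurd ⟨(hlt w' s _ hs h1.1).2, (hlt w' t _ ht h1.2).2⟩ h2
    · exact zero_le_one
    · exact le_rfl
  · refine sum_nonpos fun w' _ => ?_
    rw [if_neg]
    exact fun h => hst ⟨(hlt w' s _ hs h.1).1, (hlt w' t _ ht h.2).1⟩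

theorem biI_countBelow_corner_le {n T L m : ℕ} (hL : L ≤ m) (hT : 2 ^ m ≤ T)
    (w : List.Vector Bool n) {j : ℕ} (hj : j < L) :
    biI T (countBelow (univ ×ˢ range L)
        (fun i : List.Vector Bool n × ℕ => corner T i.1 i.2 (m - i.2)))
        (corner T w j (m - j))
      ≤ 4 * 2 ^ m + L * (16 * 2 ^ n) := by
  have ha : 2 ^ j ≤ T := (Nat.pow_le_pow_right two_pos (by omega)).trans hT
  have hb : 2 ^ (m - j) ≤ T := (Nat.pow_le_pow_right two_pos (by omega)).trans hT
  have hbox : ∀ (i : ℕ) (F : ℕ → ℕ → ℝ), ∑ s ∈ range (2 ^ j), ∑ t ∈ range (2 ^ (m - j)),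
      (if s < 2 ^ i ∧ t < 2 ^ (m - i) then F s t else 0)
      = ∑ s ∈ range (min (2 ^ j) (2 ^ i)),
          ∑ t ∈ range (min (2 ^ (m - j)) (2 ^ (m - i))), F s t := by
    intro i F
    have hr : ∀ A B : ℕ, range (min A B) = (range A).filter (· < B) := fun A B => by
      ext; simp
    simp only [hr, sum_filter, ite_and]
    refine sum_congr rfl fun s _ => ?_
    split_ifs <;> simp
  rw [biI_corner w ha hb]
  calc _ ≤ ∑ s ∈ range (2 ^ j), ∑ t ∈ range (2 ^ (m - j)), ∑ i ∈ range L,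
        (if s < 2 ^ i ∧ t < 2 ^ (m - i) then
          1 + 2 ^ n * ((3 / 4 : ℝ) ^ s * (3 / 4) ^ t) else 0) := by
        refine sum_le_sum fun s hs => sum_le_sum fun t ht => ?_
        rw [mem_range] at hs ht
        exact countBelow_corner_le id (m - ·) w (by omega) (by omega)
    _ = ∑ i ∈ range L, ∑ s ∈ range (min (2 ^ j) (2 ^ i)),
          ∑ t ∈ range (min (2 ^ (m - j)) (2 ^ (m - i))),
            (1 + 2 ^ n * ((3 / 4 : ℝ) ^ s * (3 / 4) ^ t)) := by
        rw [← sum_congr rfl fun i _ => hbox i _, sum_comm (s := range L)]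
        exact sum_congr rfl fun s _ => sum_comm
    _ ≤ ∑ i ∈ range L, (2 ^ m * (1 / 2 : ℝ) ^ (i - j + (j - i)) + 16 * 2 ^ n) := by
        refine sum_le_sum fun i hi => (sum_box_le _ _ _ (by positivity)).trans ?_
        rw [mem_range] at hi
        gcongr ?_ + _
        rw [add_comm (i - j)]
        exact_mod_cast min_mul_min_le (by omega : j ≤ m) (by omega : i ≤ m)
    _ ≤ 4 * 2 ^ m + L * (16 * 2 ^ n) := by
        rw [sum_add_distrib, ← mul_sum, sum_const, card_range, nsmul_eq_mul, mul_comm (4 : ℝ)]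
        gcongr
        exact sum_half_pow_dist_le L j

/-- **Small energy majorization on the bi-tree fails with any rate whatsoever.** -/
theorem stmt6 (h : ℝ → ℝ) (hpos : ∀ t, 0 < t → 0 < h t)
    (hlim : Filter.Tendsto h (nhdsWithin 0 (Set.Ioi 0)) (nhds 0)) :
    ∀ C : ℝ, 0 < C →
    ∃ N : ℕ, 1 ≤ N ∧ ∃ f g : List Bool × List Bool → ℝ, ∃ δ lam : ℝ,
      (∀ p, 0 ≤ f p) ∧ (∀ p, 0 ≤ g p) ∧ BiSuperadditive N g ∧
      0 < δ ∧ 10 * δ ≤ lam ∧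
      (∀ p ∈ biVertices N, f p ≠ 0 → biI N g p ≤ δ) ∧
      ¬ ∃ φ : List Bool × List Bool → ℝ, (∀ p, 0 ≤ φ p) ∧
        (∀ p ∈ biVertices N, 2 * lam ≤ biI N g p → biI N g p ≤ 4 * lam →
          biI N f p ≤ biI N φ p) ∧
        ∑ p ∈ biVertices N, (φ p) ^ 2 ≤ C * h (δ / lam) * ∑ p ∈ biVertices N, (f p) ^ 2 := by
  intro C hC
  have hscale : Filter.Tendsto (fun l : ℕ => 2 * (1 / 2 : ℝ) ^ l) Filter.atTop
      (nhdsWithin 0 (Set.Ioi 0)) := by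
    refine tendsto_nhdsWithin_iff.2 ⟨?_, Filter.Eventually.of_forall fun l => ?_⟩
    · simpa using (tendsto_pow_atTop_nhds_zero_of_lt_one (r := (1 / 2 : ℝ)) (by norm_num)
        (by norm_num)).const_mul 2
    · exact Set.mem_Ioi.2 (by positivity)
  have hsmall := (hlim.comp hscale).eventually (gt_mem_nhds (show (0 : ℝ) < 1 / (20 * C) by
    positivity))
  obtain ⟨l, hl, hl5⟩ := (hsmall.and (Filter.eventually_ge_atTop 5)).exists
  obtain ⟨n, hn⟩ : ∃ n, n = 2 ^ l := ⟨_, rfl⟩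
  have hnl : (n : ℝ) = 2 ^ l := by rw [hn]; norm_cast
  have hn32 : (32 : ℝ) ≤ n := by
    exact_mod_cast (hn ▸ Nat.pow_le_pow_right two_pos hl5 : 2 ^ 5 ≤ n)
  have hN : (0 : ℝ) < 2 ^ n := by positivity
  have hpow : (2 : ℝ) ^ (n + l) = 2 ^ n * n := by rw [pow_add, hnl]
  have hj : ∀ j < n, 2 ^ j ≤ 2 ^ (n + l) ∧ 2 ^ (n + l - j) ≤ 2 ^ (n + l) := fun j hj =>
    ⟨Nat.pow_le_pow_right two_pos (by omega), Nat.pow_le_pow_right two_pos (by omega)⟩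
  refine ⟨2 ^ (n + l), Nat.one_le_two_pow, fun q => if q = ([], []) then 1 else 0,
    wordCount n (2 ^ (n + l)), 2 ^ n, 2 ^ n * n / 2, fun p => by dsimp only; split_ifs <;> simp,
    fun p => by rw [wordCount_eq_card]; positivity, biSuperadditive_wordCount _ _ _, hN,
    by nlinarith, ?_, ?_⟩
  · intro p _ hp
    obtain rfl : p = ([], []) := by by_contra h; simp [h] at hp
    rw [biI_eq_sum_take _ _ (by simp) (by simp)]
    simp [wordCount_eq_card]
  · rintro ⟨φ, -, hφ, hsum⟩
    have hnpos : 0 < n := hn ▸ Nat.two_pow_pos l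
    have hne : ((univ : Finset (List.Vector Bool n)) ×ˢ range n).Nonempty :=
      univ_nonempty.product (nonempty_range_iff.2 hnpos.ne')
    have hcap := card_le_mul_sum_sq (2 ^ (n + l)) (F := φ) hne
      (Q := fun i => corner (2 ^ (n + l)) i.1 i.2 (n + l - i.2))
      (fun i hi => biI_countBelow_corner_le (Nat.le_add_right n l) le_rfl i.1
        (mem_range.1 (mem_product.1 hi).2))
      (fun i hi => by
        have hi' := mem_range.1 (mem_product.1 hi).2
        obtain ⟨ha, hb⟩ := hj i.2 hi'
        have hbounds := biI_wordCount_corner_bounds i.1 ha hb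
        rw [Nat.add_sub_cancel' (by omega), hpow] at hbounds
        rw [← biI_root_indicator (2 ^ (n + l)) (corner (2 ^ (n + l)) i.1 i.2 (n + l - i.2))]
        refine hφ _ ?_ (by linarith [hbounds.1]) (by nlinarith [hbounds.2])
        simp only [corner, biVertices, mem_product, mem_strings]
        exact ⟨(List.length_take_le _ _).trans ((Nat.sub_le _ _).trans ha),
          (List.length_take_le _ _).trans ((Nat.sub_le _ _).trans hb)⟩)
    rw [card_product, card_univ, card_vector, Fintype.card_bool, card_range, hpow] at hcap
    push_cast at hcap
    have hf : ∑ p ∈ biVertices (2 ^ (n + l)),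
        (if p = (([], []) : List Bool × List Bool) then (1 : ℝ) else 0) ^ 2 = 1 := by
      simp [biVertices, mem_strings]
    have hratio : (2 : ℝ) ^ n / (2 ^ n * n / 2) = 2 * (1 / 2) ^ l := by
      rw [hnl, one_div, inv_pow]
      field_simp
    rw [hf, hratio, mul_one] at hsum
    have hlt : C * h (2 * (1 / 2) ^ l) < 1 / 20 := by
      calc _ < C * (1 / (20 * C)) := mul_lt_mul_of_pos_left hl hC
        _ = 1 / 20 := by field_simp
    have hprod : (0 : ℝ) < 2 ^ n * n := by positivity
    nlinarith
end

section
/- Surrogate maximum principle on the bi-tree: there is an absolute constant c₀ such that for every N ≥ 1, every nonzero measure ν on the boundary of the bi-tree T² of depth N, and every ε > 0, if E[ν] ≥ 2ε|ν| then E_ε[ν] ≤ ε·exp(c₀·√(log(E[ν]/(ε|ν|))))·|ν|. -/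
open Finset

namespace BiTree

theorem mem_strings {N : ℕ} {l : List Bool} : l ∈ strings N ↔ l.length ≤ N := by
  induction N generalizing l with
  | zero => simp [strings]
  | succ n ih =>
    rcases l with _ | ⟨b, t⟩
    · simp [strings]
    · cases b <;> simp [strings, ih]

/-- The prefixes of a string, i.e. its ancestors in the dyadic tree. -/
def pre (x : List Bool) : Finset (List Bool) := x.inits.toFinset

theorem mem_pre {x z : List Bool} : z ∈ pre x ↔ z <+: x := by simp [pre]

theorem pre_nil : pre [] = {[]} := by ext; simp [mem_pre]

theorem sum_pre_concat (u : List Bool → ℝ) (x : List Bool) (c : Bool) :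
    ∑ z ∈ pre (x ++ [c]), u z = ∑ z ∈ pre x, u z + u (x ++ [c]) := by
  have h : pre (x ++ [c]) = insert (x ++ [c]) (pre x) := by
    ext z; simp [mem_pre, List.prefix_concat_iff]
  rw [h, sum_insert, add_comm]
  rw [mem_pre]
  intro h
  simpa using h.length_le

theorem pre_subset_strings {N : ℕ} {x : List Bool} (hx : x ∈ strings N) : pre x ⊆ strings N := by
  intro z hz
  exact mem_strings.2 ((mem_pre.1 hz).length_le.trans (mem_strings.1 hx))

theorem pre_mono {x y : List Bool} (h : x <+: y) : pre x ⊆ pre y :=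
  fun _ hz => mem_pre.2 ((mem_pre.1 hz).trans h)

theorem sum_pre_mono {u : List Bool → ℝ} (hu : ∀ z, 0 ≤ u z) {x y : List Bool} (h : x <+: y) :
    ∑ z ∈ pre x, u z ≤ ∑ z ∈ pre y, u z :=
  sum_le_sum_of_subset_of_nonneg (pre_mono h) fun z _ _ => hu z

theorem le_sum_pre {u : List Bool → ℝ} (hu : ∀ z, 0 ≤ u z) (x : List Bool) :
    u x ≤ ∑ z ∈ pre x, u z :=
  single_le_sum (fun z _ => hu z) (mem_pre.2 (List.prefix_refl x))

theorem sum_pre_eq {N : ℕ} {x : List Bool} (hx : x ∈ strings N) (u : List Bool → ℝ) :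
    ∑ z ∈ pre x, u z = ∑ z ∈ strings N, if z <+: x then u z else 0 := by
  rw [← sum_filter]
  congr 1
  ext z
  simp only [mem_pre, mem_filter]
  exact ⟨fun h => ⟨pre_subset_strings hx (mem_pre.2 h), h⟩, fun h => h.2⟩

theorem sq_sum_pre_le {v : List Bool → ℝ} (hv : ∀ z, 0 ≤ v z) (x : List Bool) :
    (∑ z ∈ pre x, v z) ^ 2 ≤ 2 * ∑ z ∈ pre x, v z * ∑ w ∈ pre z, v w := by
  induction x using List.reverseRecOn with
  | nil => simp only [pre_nil, sum_singleton]; nlinarith [hv []]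
  | append_singleton x c ih =>
    simp only [sum_pre_concat]
    nlinarith [hv (x ++ [c])]

/-- Superadditivity on the simple tree of depth `N`. -/
def Superadd (N : ℕ) (u : List Bool → ℝ) : Prop :=
  ∀ a : List Bool, a.length < N → u (a ++ [false]) + u (a ++ [true]) ≤ u a

theorem ite_prefix_split (φ : List Bool → ℝ) (a c : List Bool) :
    (if a <+: c then φ c else 0) = (if c = a then φ c else 0) +
      ((if a ++ [false] <+: c then φ c else 0) + (if a ++ [true] <+: c then φ c else 0)) := by
  by_cases h : a <+: c
  · obtain ⟨t, rfl⟩ := h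
    rcases t with _ | ⟨b, t⟩
    · have h1 : ∀ b, ¬ a ++ [b] <+: a := fun b h => by simpa using h.length_le
      simp [h1]
    · cases b <;> simp
  · have h1 : ∀ b, ¬ a ++ [b] <+: c := fun b hb => h ((List.prefix_append a [b]).trans hb)
    have h2 : c ≠ a := by rintro rfl; exact h (List.prefix_refl _)
    simp [h, h1, h2]

theorem sum_below_split {N : ℕ} (φ : List Bool → ℝ) {a : List Bool} (ha : a.length ≤ N) :
    (∑ c ∈ strings N, if a <+: c then φ c else 0) = φ a +
      ((∑ c ∈ strings N, if a ++ [false] <+: c then φ c else 0) +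
        ∑ c ∈ strings N, if a ++ [true] <+: c then φ c else 0) := by
  simp_rw [ite_prefix_split φ a, sum_add_distrib, sum_ite_eq', if_pos (mem_strings.2 ha)]

theorem sum_below_eq_zero {N : ℕ} (φ : List Bool → ℝ) {a : List Bool} (ha : N < a.length) :
    (∑ c ∈ strings N, if a <+: c then φ c else 0) = 0 := by
  refine sum_eq_zero fun c hc => if_neg fun h => ?_
  have := h.length_le
  have := mem_strings.1 hc
  omega

theorem sum_sq_below_aux {N : ℕ} {u : List Bool → ℝ} (hu : ∀ z, 0 ≤ u z) (hs : Superadd N u)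
    (Λ : ℝ) (n : ℕ) : ∀ a : List Bool, a.length + n = N + 1 →
    (∑ c ∈ strings N, if a <+: c then (if ∑ z ∈ pre c, u z ≤ Λ then u c ^ 2 else 0) else 0) ≤
      max 0 (Λ - ∑ z ∈ pre a, u z + u a) * u a := by
  induction n with
  | zero =>
    intro a ha
    rw [sum_below_eq_zero _ (by omega)]
    exact mul_nonneg (le_max_left _ _) (hu a)
  | succ n ih =>
    intro a ha
    by_cases h : ∑ z ∈ pre a, u z ≤ Λ
    · rw [sum_below_split _ (by omega), if_pos h]
      have h0 := ih (a ++ [false]) (by simp; omega)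
      have h1 := ih (a ++ [true]) (by simp; omega)
      rw [sum_pre_concat, sub_add_eq_sub_sub, sub_add_cancel, max_eq_right (by linarith)] at h0 h1
      have h3 : Λ - ∑ z ∈ pre a, u z + u a ≤ max 0 (Λ - ∑ z ∈ pre a, u z + u a) := le_max_right _ _
      have h4 := mul_le_mul_of_nonneg_right h3 (hu a)
      rcases Nat.lt_or_ge a.length N with hl | hl
      · have h2 := mul_le_mul_of_nonneg_left (hs a hl) (sub_nonneg.2 h)
        nlinarith
      · rw [sum_below_eq_zero _ (by simp; omega), sum_below_eq_zero _ (by simp; omega)]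
        nlinarith [hu a]
    · rw [sum_eq_zero]
      · exact mul_nonneg (le_max_left _ _) (hu a)
      · intro c _
        split_ifs with h1 h2
        · exact absurd ((sum_pre_mono hu h1).trans h2) h
        · rfl
        · rfl

theorem sum_sq_below_le {N : ℕ} {u : List Bool → ℝ} (hu : ∀ z, 0 ≤ u z) (hs : Superadd N u)
    {Λ : ℝ} (hΛ : 0 ≤ Λ) {a : List Bool} (ha : a ∈ strings N) :
    (∑ c ∈ strings N, if a <+: c then (if ∑ z ∈ pre c, u z ≤ Λ then u c ^ 2 else 0) else 0) ≤
      Λ * u a := by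
  have hl := mem_strings.1 ha
  refine (sum_sq_below_aux hu hs Λ (N + 1 - a.length) a (by omega)).trans ?_
  gcongr
  · exact hu a
  · exact max_le hΛ (by linarith [le_sum_pre hu a])

/-- One-dimensional weighted Hardy inequality with a cut-off. -/
theorem sum_sq_mul_sq_le {N : ℕ} {u v : List Bool → ℝ} (hu : ∀ z, 0 ≤ u z) (hs : Superadd N u)
    (hv : ∀ z, 0 ≤ v z) {Λ : ℝ} (hΛ : 0 ≤ Λ) :
    (∑ c ∈ strings N, if ∑ z ∈ pre c, u z ≤ Λ then ((∑ z ∈ pre c, v z) * u c) ^ 2 else 0) ≤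
      2 * Λ * ∑ a ∈ strings N, v a * (∑ z ∈ pre a, v z) * u a := by
  calc _ ≤ ∑ c ∈ strings N, ∑ a ∈ strings N, 2 * (v a * ∑ z ∈ pre a, v z) *
        (if a <+: c then (if ∑ z ∈ pre c, u z ≤ Λ then u c ^ 2 else 0) else 0) := by
        refine sum_le_sum fun c hc => ?_
        split_ifs with h
        · have h1 := sq_sum_pre_le hv c
          rw [sum_pre_eq hc (fun z => v z * ∑ w ∈ pre z, v w)] at h1
          rw [mul_pow]
          refine (mul_le_mul_of_nonneg_right h1 (sq_nonneg _)).trans (le_of_eq ?_)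
          rw [mul_assoc, sum_mul, mul_sum]
          refine sum_congr rfl fun a _ => ?_
          split_ifs <;> ring
        · simp
    _ = ∑ a ∈ strings N, 2 * (v a * ∑ z ∈ pre a, v z) * ∑ c ∈ strings N,
        (if a <+: c then (if ∑ z ∈ pre c, u z ≤ Λ then u c ^ 2 else 0) else 0) := by
        rw [sum_comm]
        simp only [← mul_sum]
    _ ≤ ∑ a ∈ strings N, 2 * (v a * ∑ z ∈ pre a, v z) * (Λ * u a) := by
        refine sum_le_sum fun a ha => ?_
        refine mul_le_mul_of_nonneg_left (sum_sq_below_le hu hs hΛ ha) ?_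
        have := hv a
        have := sum_nonneg (s := pre a) fun z _ => hv z
        positivity
    _ = _ := by
        rw [mul_sum]
        exact sum_congr rfl fun a _ => by ring

/-- If `r` has jumps at most `δ`, the mass of `r` before its partial sums exceed `t` is at least
`t - δ`, unless the total mass is smaller. -/
theorem min_le_sum_truncated {r : List Bool → ℝ} (hr : ∀ z, 0 ≤ r z) {δ : ℝ}
    (hδ : ∀ z, r z ≤ δ) (t : ℝ) (y : List Bool) :
    min (∑ w ∈ pre y, r w) (t - δ) ≤
      ∑ w ∈ pre y, if ∑ z ∈ pre w, r z ≤ t then r w else 0 := by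
  induction y using List.reverseRecOn with
  | nil =>
    simp only [pre_nil, sum_singleton]
    split_ifs with h
    · exact min_le_left _ _
    · push Not at h
      have := hδ []
      have h0 := hr []
      exact (min_le_right _ _).trans (by linarith)
  | append_singleton x c ih =>
    by_cases h : ∑ z ∈ pre (x ++ [c]), r z ≤ t
    · refine (min_le_left _ _).trans (sum_le_sum fun w hw => ?_)
      rw [if_pos ((sum_pre_mono hr (mem_pre.1 hw)).trans h)]
    · simp only [sum_pre_concat] at h ⊢
      have := hδ (x ++ [c])
      push Not at h
      rw [min_eq_right (by linarith)] at ih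
      rw [if_neg (by linarith), add_zero]
      exact (min_le_right _ _).trans ih

/-- Partial Hardy operator in the first variable. -/
def hardy₁ (f : List Bool → List Bool → ℝ) (a b : List Bool) : ℝ := ∑ z ∈ pre a, f z b

/-- Partial Hardy operator in the second variable. -/
def hardy₂ (f : List Bool → List Bool → ℝ) (a b : List Bool) : ℝ := ∑ w ∈ pre b, f a w

/-- The Hardy operator `𝕀`, for functions in curried form. -/
def hardy (f : List Bool → List Bool → ℝ) (a b : List Bool) : ℝ :=
  ∑ z ∈ pre a, ∑ w ∈ pre b, f z w

/-- The restriction of `g` to the set where `F ≤ t`. -/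
noncomputable def cut (F g : List Bool → List Bool → ℝ) (t : ℝ) (a b : List Bool) : ℝ :=
  if F a b ≤ t then g a b else 0

/-- The bilinear form collecting the products of `f` and `p` over incomparable pairs. -/
def cross (f p : List Bool → List Bool → ℝ) (a b : List Bool) : ℝ :=
  hardy₁ f a b * hardy₂ p a b + hardy₂ f a b * hardy₁ p a b

section TwoParameters

variable {N : ℕ} {f g p F : List Bool → List Bool → ℝ}

theorem hardy_eq_sum_hardy₂ (f : List Bool → List Bool → ℝ) (a b : List Bool) :
    hardy f a b = ∑ z ∈ pre a, hardy₂ f z b := rfl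

theorem hardy_eq_sum_hardy₁ (f : List Bool → List Bool → ℝ) (a b : List Bool) :
    hardy f a b = ∑ w ∈ pre b, hardy₁ f a w := sum_comm

theorem hardy_flip (f : List Bool → List Bool → ℝ) (a b : List Bool) :
    hardy (flip f) a b = hardy f b a := sum_comm

theorem hardy₁_nonneg (hf : ∀ a b, 0 ≤ f a b) (a b : List Bool) : 0 ≤ hardy₁ f a b :=
  sum_nonneg fun _ _ => hf _ _

theorem hardy₂_nonneg (hf : ∀ a b, 0 ≤ f a b) (a b : List Bool) : 0 ≤ hardy₂ f a b :=
  sum_nonneg fun _ _ => hf _ _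

theorem hardy_nonneg (hf : ∀ a b, 0 ≤ f a b) (a b : List Bool) : 0 ≤ hardy f a b :=
  sum_nonneg fun _ _ => hardy₂_nonneg hf _ _

theorem cut_nonneg (hg : ∀ a b, 0 ≤ g a b) (t : ℝ) (a b : List Bool) : 0 ≤ cut F g t a b := by
  unfold cut; split_ifs
  exacts [hg a b, le_rfl]

theorem cut_le (hg : ∀ a b, 0 ≤ g a b) (t : ℝ) (a b : List Bool) : cut F g t a b ≤ g a b := by
  unfold cut; split_ifs
  exacts [le_rfl, hg a b]

theorem hardy_mono (hf : ∀ a b, 0 ≤ f a b) {a b x y : List Bool} (ha : a <+: x) (hb : b <+: y) :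
    hardy f a b ≤ hardy f x y :=
  (sum_pre_mono (hardy₂_nonneg hf · b) ha).trans
    (sum_le_sum fun z _ => sum_pre_mono (hf z) hb)

theorem hardy_le_hardy (h : ∀ a b, f a b ≤ g a b) (a b : List Bool) :
    hardy f a b ≤ hardy g a b :=
  sum_le_sum fun _ _ => sum_le_sum fun _ _ => h _ _

theorem hardy₁_le_hardy (hf : ∀ a b, 0 ≤ f a b) (a b : List Bool) :
    hardy₁ f a b ≤ hardy f a b := by
  rw [hardy_eq_sum_hardy₁]
  exact le_sum_pre (hardy₁_nonneg hf a) b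

theorem superadd_cut (hg : ∀ a b, 0 ≤ g a b) (hF : ∀ a c b, F a b ≤ F (a ++ [c]) b)
    (hs : ∀ b, Superadd N fun a => g a b) (t : ℝ) (b : List Bool) :
    Superadd N fun a => cut F g t a b := by
  intro a ha
  by_cases h : F a b ≤ t
  · have h1 := hs b a ha
    have h2 := cut_le (F := F) hg t (a ++ [false]) b
    have h3 := cut_le (F := F) hg t (a ++ [true]) b
    simp only [cut, if_pos h] at h1 h2 h3 ⊢
    linarith
  · have h1 : ∀ c, ¬ F (a ++ [c]) b ≤ t := fun c hc => h ((hF a c b).trans hc)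
    simp [cut, h, h1]

theorem superadd_hardy₂ (hs : ∀ b, Superadd N fun a => g a b) (b : List Bool) :
    Superadd N fun a => hardy₂ g a b := by
  intro a ha
  simp only [hardy₂, ← sum_add_distrib]
  exact sum_le_sum fun w _ => hs w a ha

theorem sum_sq_hardy_mul_le (hf : ∀ a b, 0 ≤ f a b) (hp : ∀ a b, 0 ≤ p a b)
    (hs : ∀ b, Superadd N fun a => p a b) {Λ : ℝ} (hΛ : 0 ≤ Λ) :
    (∑ a ∈ strings N, ∑ b ∈ strings N,
      if hardy p a b ≤ Λ then (hardy₁ f a b * hardy₂ p a b) ^ 2 else 0) ≤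
    2 * Λ * ∑ a ∈ strings N, ∑ b ∈ strings N, f a b * hardy₁ f a b * hardy₂ p a b := by
  rw [sum_comm, sum_comm (f := fun a b => f a b * hardy₁ f a b * hardy₂ p a b), mul_sum]
  exact sum_le_sum fun b _ => sum_sq_mul_sq_le (hardy₂_nonneg hp · b) (superadd_hardy₂ hs b)
    (hf · b) hΛ

/-- The standing data: a nonnegative `g`, superadditive in each variable. -/
structure IsSuper (N : ℕ) (g : List Bool → List Bool → ℝ) : Prop where
  nonneg : ∀ a b, 0 ≤ g a b
  left : ∀ b, Superadd N fun a => g a b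
  right : ∀ a, Superadd N fun b => g a b

theorem IsSuper.flip (hg : IsSuper N g) : IsSuper N (flip g) :=
  ⟨fun a b => hg.nonneg b a, hg.right, hg.left⟩

theorem IsSuper.cut_hardy (hg : IsSuper N g) (hf : ∀ a b, 0 ≤ f a b) (t : ℝ) :
    IsSuper N (cut (hardy f) g t) where
  nonneg := cut_nonneg hg.nonneg t
  left := superadd_cut hg.nonneg
    (fun a c b => hardy_mono hf (List.prefix_append a [c]) (List.prefix_refl b)) hg.left t
  right := fun a => superadd_cut (F := Function.swap (hardy f)) (g := Function.swap g)
    (fun a b => hg.nonneg b a)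
    (fun b c a => hardy_mono hf (List.prefix_refl a) (List.prefix_append b [c])) hg.right t a

theorem hardy₁_cut_le (hg : ∀ a b, 0 ≤ g a b) {δ : ℝ} (hδ : 0 ≤ δ) (a b : List Bool) :
    hardy₁ (cut (hardy g) g δ) a b ≤ δ := by
  have key : ∀ a, hardy g a b ≤ δ → hardy₁ (cut (hardy g) g δ) a b ≤ δ := fun a h =>
    ((sum_le_sum fun z _ => cut_le hg δ z b).trans (hardy₁_le_hardy hg a b)).trans h
  induction a using List.reverseRecOn with
  | nil =>
    by_cases h : hardy g [] b ≤ δ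
    · exact key _ h
    · simpa [hardy₁, pre_nil, cut, h] using hδ
  | append_singleton x c ih =>
    by_cases h : hardy g (x ++ [c]) b ≤ δ
    · exact key _ h
    · have : hardy₁ (cut (hardy g) g δ) (x ++ [c]) b = hardy₁ (cut (hardy g) g δ) x b := by
        simp [hardy₁, sum_pre_concat, cut, h]
      rw [this]
      exact ih

theorem cut_flip (g : List Bool → List Bool → ℝ) (δ : ℝ) :
    cut (hardy (flip g)) (flip g) δ = flip (cut (hardy g) g δ) := by
  funext a b
  simp [cut, hardy_flip, flip]

theorem hardy₂_cut_le (hg : ∀ a b, 0 ≤ g a b) {δ : ℝ} (hδ : 0 ≤ δ) (a b : List Bool) :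
    hardy₂ (cut (hardy g) g δ) a b ≤ δ := by
  have := hardy₁_cut_le (g := flip g) (fun a b => hg b a) hδ b a
  rwa [cut_flip] at this

theorem cut_mul_le (hg : ∀ a b, 0 ≤ g a b) (hpg : ∀ a b, p a b ≤ g a b)
    (δ : ℝ) (a b : List Bool) :
    cut (hardy g) g δ a b * hardy₂ p a b ≤
      cut (hardy g) g δ a b * hardy₂ (cut (hardy g) g δ) a b := by
  by_cases h : hardy g a b ≤ δ
  · refine mul_le_mul_of_nonneg_left (sum_le_sum fun w hw => ?_) (cut_nonneg hg δ a b)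
    rw [cut, if_pos ((hardy_mono hg (List.prefix_refl a) (mem_pre.1 hw)).trans h)]
    exact hpg a w
  · simp [cut, h]

/-- Cubic estimate at scale `δ`. -/
theorem sum_cut_mul_hardy_le (hg : IsSuper N g) {δ : ℝ} (hδ : 0 ≤ δ) :
    ∑ a ∈ strings N, ∑ b ∈ strings N, cut (hardy g) g δ a b * hardy₁ (cut (hardy g) g δ) a b *
      hardy₂ (cut (hardy g) g δ) a b ≤
    2 * δ * ∑ a ∈ strings N, ∑ b ∈ strings N, cut (hardy g) g δ a b ^ 2 := by
  have hf := cut_nonneg (F := hardy g) hg.nonneg δ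
  have hsf := (hg.cut_hardy hg.nonneg δ).left
  set f := cut (hardy g) g δ with hfdef
  have h1 := sum_sq_hardy_mul_le hf hf hsf hδ
  set X := ∑ a ∈ strings N, ∑ b ∈ strings N, f a b * hardy₁ f a b * hardy₂ f a b with hX
  have hX0 : 0 ≤ X := sum_nonneg fun a _ => sum_nonneg fun b _ =>
    mul_nonneg (mul_nonneg (hf a b) (hardy₁_nonneg hf a b)) (hardy₂_nonneg hf a b)
  have h2 : X ^ 2 ≤ (∑ a ∈ strings N, ∑ b ∈ strings N, f a b ^ 2) * (2 * δ * X) := by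
    refine le_trans ?_ (mul_le_mul_of_nonneg_left h1
      (sum_nonneg fun a _ => sum_nonneg fun b _ => sq_nonneg _))
    rw [hX]
    simp only [← sum_product']
    refine sum_sq_le_sum_mul_sum_of_sq_le_mul _ (fun _ _ => sq_nonneg _)
      (fun _ _ => by split_ifs; exacts [sq_nonneg _, le_rfl]) fun q _ => ?_
    split_ifs with h
    · exact le_of_eq (by ring)
    · have : f q.1 q.2 = 0 := if_neg fun h' =>
        h ((hardy_le_hardy (cut_le hg.nonneg δ) _ _).trans h')
      simp [this]
  by_contra! h
  have hS : 0 ≤ ∑ a ∈ strings N, ∑ b ∈ strings N, f a b ^ 2 :=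
    sum_nonneg fun a _ => sum_nonneg fun b _ => sq_nonneg _
  nlinarith [mul_nonneg hδ hS]

/-- Norm estimate for one half of the crossing form. -/
theorem sum_sq_hardy_cut_mul_le (hg : IsSuper N g) (hp : IsSuper N p)
    (hpg : ∀ a b, p a b ≤ g a b) {δ Λ : ℝ} (hδ : 0 ≤ δ) (hΛ : 0 ≤ Λ) :
    (∑ a ∈ strings N, ∑ b ∈ strings N, if hardy p a b ≤ Λ then
      (hardy₁ (cut (hardy g) g δ) a b * hardy₂ p a b) ^ 2 else 0) ≤
    4 * Λ * δ * ∑ a ∈ strings N, ∑ b ∈ strings N, cut (hardy g) g δ a b ^ 2 := by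
  have hf := cut_nonneg (F := hardy g) hg.nonneg δ
  refine (sum_sq_hardy_mul_le hf hp.nonneg hp.left hΛ).trans ?_
  have h1 := sum_cut_mul_hardy_le hg hδ
  have h2 : ∑ a ∈ strings N, ∑ b ∈ strings N, cut (hardy g) g δ a b *
        hardy₁ (cut (hardy g) g δ) a b * hardy₂ p a b ≤
      ∑ a ∈ strings N, ∑ b ∈ strings N, cut (hardy g) g δ a b *
        hardy₁ (cut (hardy g) g δ) a b * hardy₂ (cut (hardy g) g δ) a b := by
    refine sum_le_sum fun a _ => sum_le_sum fun b _ => ?_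
    rw [mul_right_comm, mul_right_comm _ _ (hardy₂ (cut _ _ _) a b)]
    exact mul_le_mul_of_nonneg_right (cut_mul_le hg.nonneg hpg δ a b)
      (hardy₁_nonneg hf a b)
  have := mul_le_mul_of_nonneg_left (h2.trans h1) (by positivity : 0 ≤ 2 * Λ)
  linarith

theorem sum_sq_cross_le (hg : IsSuper N g) (hp : IsSuper N p)
    (hpg : ∀ a b, p a b ≤ g a b) {δ Λ : ℝ} (hδ : 0 ≤ δ) (hΛ : 0 ≤ Λ) :
    (∑ a ∈ strings N, ∑ b ∈ strings N, if hardy p a b ≤ Λ then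
      cross (cut (hardy g) g δ) p a b ^ 2 else 0) ≤
    16 * Λ * δ * ∑ a ∈ strings N, ∑ b ∈ strings N, cut (hardy g) g δ a b ^ 2 := by
  have h1 := sum_sq_hardy_cut_mul_le hg hp hpg hδ hΛ
  have h2 := sum_sq_hardy_cut_mul_le hg.flip hp.flip (fun a b => hpg b a) hδ hΛ
  rw [cut_flip, sum_comm, sum_comm (f := fun a b => flip (cut (hardy g) g δ) a b ^ 2)] at h2
  simp only [hardy_flip] at h2
  set f := cut (hardy g) g δ
  change (∑ a ∈ strings N, ∑ b ∈ strings N, if hardy p a b ≤ Λ then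
      (hardy₂ f a b * hardy₁ p a b) ^ 2 else 0) ≤
    4 * Λ * δ * ∑ a ∈ strings N, ∑ b ∈ strings N, f a b ^ 2 at h2
  have h3 : (∑ a ∈ strings N, ∑ b ∈ strings N, if hardy p a b ≤ Λ then
      cross f p a b ^ 2 else 0) ≤
    2 * (∑ a ∈ strings N, ∑ b ∈ strings N, if hardy p a b ≤ Λ then
      (hardy₁ f a b * hardy₂ p a b) ^ 2 else 0) +
    2 * (∑ a ∈ strings N, ∑ b ∈ strings N, if hardy p a b ≤ Λ then
      (hardy₂ f a b * hardy₁ p a b) ^ 2 else 0) := by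
    simp only [mul_sum, ← sum_add_distrib]
    refine sum_le_sum fun a _ => sum_le_sum fun b _ => ?_
    split_ifs
    · unfold cross
      nlinarith [sq_nonneg (hardy₁ f a b * hardy₂ p a b - hardy₂ f a b * hardy₁ p a b)]
    · simp
  linarith

theorem sum_pre_mul_sum_pre (q R : List Bool → ℝ) (y : List Bool) :
    (∑ b ∈ pre y, q b * ∑ w ∈ pre y, if b <+: w then R w else 0) =
      ∑ w ∈ pre y, R w * ∑ b ∈ pre w, q b := by
  simp only [mul_sum]
  rw [sum_comm]
  refine sum_congr rfl fun w hw => ?_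
  have : pre w = (pre y).filter (fun b => b <+: w) := by
    ext b
    simp only [mem_pre, mem_filter]
    exact ⟨fun h => ⟨h.trans (mem_pre.1 hw), h⟩, fun h => h.2⟩
  rw [this, sum_filter]
  refine sum_congr rfl fun b _ => ?_
  split_ifs <;> ring

theorem sum_pre_ite_prefix (r : List Bool → ℝ) {b y : List Bool} (hb : b <+: y) :
    (∑ w ∈ pre y, if w <+: b then r w else 0) = ∑ w ∈ pre b, r w := by
  rw [← sum_filter]
  congr 1
  ext w
  simp only [mem_pre, mem_filter]
  exact ⟨fun h => h.2, fun h => ⟨h.trans hb, h⟩⟩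

theorem le_sum_below_truncated {r : List Bool → ℝ} (hr : ∀ z, 0 ≤ r z) {δ σ : ℝ}
    (hδ : ∀ z, r z ≤ δ) (hδσ : δ ≤ σ) {b y : List Bool} (hb : b <+: y)
    (hrb : ∑ w ∈ pre b, r w ≤ σ) (hry : 2 * σ ≤ ∑ w ∈ pre y, r w) :
    σ ≤ ∑ w ∈ pre y, if b <+: w then (if ∑ z ∈ pre w, r z ≤ 3 * σ then r w else 0) else 0 := by
  have h1 := min_le_sum_truncated hr hδ (3 * σ) y
  have h2 : 2 * σ ≤ min (∑ w ∈ pre y, r w) (3 * σ - δ) := le_min hry (by linarith)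
  rw [← sum_pre_ite_prefix r hb] at hrb
  have h3 : (∑ w ∈ pre y, if ∑ z ∈ pre w, r z ≤ 3 * σ then r w else 0) ≤
      (∑ w ∈ pre y, if b <+: w then (if ∑ z ∈ pre w, r z ≤ 3 * σ then r w else 0) else 0) +
      ∑ w ∈ pre y, if w <+: b then r w else 0 := by
    rw [← sum_add_distrib]
    refine sum_le_sum fun w hw => ?_
    have := hr w
    rcases List.prefix_or_prefix_of_prefix hb (mem_pre.1 hw) with h | h
    · rw [if_pos h]
      split_ifs <;> linarith
    · rw [if_pos h]
      split_ifs <;> linarith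
  linarith

theorem hardy_le_add_add (hf : ∀ a b, 0 ≤ f a b) {a b x y : List Bool} (ha : a <+: x)
    (hb : b <+: y) :
    hardy f x y ≤ hardy f a y + hardy f x b +
      ∑ z ∈ pre x, if a <+: z then (∑ w ∈ pre y, if b <+: w then f z w else 0) else 0 := by
  rw [hardy_eq_sum_hardy₂ f a y, ← sum_pre_ite_prefix _ ha, hardy_eq_sum_hardy₂ f x b,
    hardy_eq_sum_hardy₂ f x y, ← sum_add_distrib, ← sum_add_distrib]
  refine sum_le_sum fun z hz => ?_
  have h1 := hardy₂_nonneg hf z y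
  have h2 := hardy₂_nonneg hf z b
  have h3 : 0 ≤ ∑ w ∈ pre y, if b <+: w then f z w else 0 :=
    sum_nonneg fun w _ => by split_ifs; exacts [hf z w, le_rfl]
  rcases List.prefix_or_prefix_of_prefix ha (mem_pre.1 hz) with h | h
  · have h4 : hardy₂ f z y ≤ hardy₂ f z b + ∑ w ∈ pre y, if b <+: w then f z w else 0 := by
      rw [hardy₂, hardy₂, ← sum_pre_ite_prefix _ hb, ← sum_add_distrib]
      refine sum_le_sum fun w hw => ?_
      have := hf z w
      rcases List.prefix_or_prefix_of_prefix hb (mem_pre.1 hw) with h' | h' <;> rw [if_pos h'] <;>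
        split_ifs <;> linarith
    rw [if_pos h]
    split_ifs <;> linarith
  · rw [if_pos h]
    split_ifs <;> linarith

theorem sum_mul_sum_below (f p : List Bool → List Bool → ℝ) (x y : List Bool) :
    (∑ a ∈ pre x, ∑ b ∈ pre y, p a b *
      ∑ z ∈ pre x, if a <+: z then (∑ w ∈ pre y, if b <+: w then f z w else 0) else 0) =
    ∑ z ∈ pre x, ∑ w ∈ pre y, f z w * hardy p z w := by
  rw [sum_comm]
  calc _ = ∑ b ∈ pre y, ∑ z ∈ pre x, (∑ w ∈ pre y, if b <+: w then f z w else 0) * hardy₁ p z b :=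
        sum_congr rfl fun b _ => sum_pre_mul_sum_pre (fun a => p a b)
          (fun z => ∑ w ∈ pre y, if b <+: w then f z w else 0) x
    _ = ∑ z ∈ pre x, ∑ b ∈ pre y, hardy₁ p z b * ∑ w ∈ pre y, if b <+: w then f z w else 0 := by
        rw [sum_comm]
        simp only [mul_comm]
    _ = _ := by
        refine sum_congr rfl fun z _ => ?_
        rw [sum_pre_mul_sum_pre]
        simp only [← hardy_eq_sum_hardy₁]

/-- The mass of `g` over the set where the truncated potential is small is not negligible. -/
theorem sub_le_hardy_cut (hg : ∀ a b, 0 ≤ g a b) {δ σ : ℝ} (hδ : 0 ≤ δ) {x y : List Bool}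
    (hxy : σ ≤ hardy (cut (hardy g) g δ) x y) :
    σ - δ ≤ hardy (cut (hardy (cut (hardy g) g δ)) g σ) x y := by
  have hf := cut_nonneg (F := hardy g) hg δ
  have hfg := cut_le (F := hardy g) hg δ
  have hfδ := hardy₁_cut_le hg hδ
  set f := cut (hardy g) g δ
  have h1 := min_le_sum_truncated (hardy₁_nonneg hf x) (hfδ x) σ y
  rw [← hardy_eq_sum_hardy₁, min_eq_right (by linarith)] at h1
  refine h1.trans ?_
  rw [hardy_eq_sum_hardy₁]
  refine sum_le_sum fun w _ => ?_
  rw [← hardy_eq_sum_hardy₁]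
  split_ifs with h
  · refine sum_le_sum fun z hz => ?_
    rw [cut, if_pos ((hardy_mono hf (mem_pre.1 hz) (List.prefix_refl w)).trans h)]
    exact hfg z w
  · exact hardy₁_nonneg (cut_nonneg hg σ) x w

/-- Lower bound for the crossing form, restricted to the set where the truncated potential
is at most `3σ`. -/
theorem mul_hardy_cut_le_hardy_cross (hg : ∀ a b, 0 ≤ g a b) {δ σ : ℝ} (hδ : 0 < δ)
    (hσ : 5 * δ ≤ σ) {x y : List Bool} (hxy : 8 * σ ≤ hardy (cut (hardy g) g δ) x y) :
    σ / 2 * hardy (cut (hardy (cut (hardy g) g δ)) g σ) x y ≤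
      hardy (cut (hardy (cut (hardy g) g δ))
        (cross (cut (hardy g) g δ) (cut (hardy (cut (hardy g) g δ)) g σ)) (3 * σ)) x y := by
  have hσ0 : 0 < σ := by linarith
  have hf := cut_nonneg (F := hardy g) hg δ
  have hf₁ := hardy₁_cut_le hg hδ.le
  have hf₂ := hardy₂_cut_le hg hδ.le
  have hp := cut_nonneg (F := hardy (cut (hardy g) g δ)) hg σ
  have hpg := cut_le (F := hardy (cut (hardy g) g δ)) hg σ
  have hp4 := sub_le_hardy_cut hg hδ.le (by linarith : σ ≤ hardy (cut (hardy g) g δ) x y)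
  have hfV : ∀ a b, cut (hardy g) g δ a b * hardy g a b ≤ cut (hardy g) g δ a b * δ := fun a b => by
    unfold cut; split_ifs with h
    · exact mul_le_mul_of_nonneg_left h (hg a b)
    · simp
  set f := cut (hardy g) g δ
  set p := cut (hardy f) g σ with hpdef
  set s := hardy f x y with hs
  have hs0 : 0 < s := by linarith
  have point : ∀ a ∈ pre x, ∀ b ∈ pre y, p a b * σ ≤
      p a b * (∑ w ∈ pre y, if b <+: w then cut (hardy f) (hardy₁ f) (3 * σ) a w else 0) +
      p a b * (∑ z ∈ pre x, if a <+: z then cut (hardy f) (hardy₂ f) (3 * σ) z b else 0) +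
      2 * σ / s * (p a b * ∑ z ∈ pre x, if a <+: z then
        (∑ w ∈ pre y, if b <+: w then f z w else 0) else 0) := by
    intro a ha b hb
    rw [mem_pre] at ha hb
    by_cases hab : hardy f a b ≤ σ
    · rw [mul_left_comm, ← mul_add, ← mul_add]
      refine mul_le_mul_of_nonneg_left ?_ (hp a b)
      have t1 : 0 ≤ ∑ w ∈ pre y, if b <+: w then cut (hardy f) (hardy₁ f) (3 * σ) a w else 0 :=
        sum_nonneg fun w _ => by
          split_ifs
          exacts [cut_nonneg (hardy₁_nonneg hf) _ _ _, le_rfl]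
      have t2 : 0 ≤ ∑ z ∈ pre x, if a <+: z then cut (hardy f) (hardy₂ f) (3 * σ) z b else 0 :=
        sum_nonneg fun w _ => by
          split_ifs
          exacts [cut_nonneg (hardy₂_nonneg hf) _ _ _, le_rfl]
      have t3 : 0 ≤ ∑ z ∈ pre x, if a <+: z then
          (∑ w ∈ pre y, if b <+: w then f z w else 0) else 0 :=
        sum_nonneg fun z _ => by
          split_ifs
          · exact sum_nonneg fun w _ => by split_ifs; exacts [hf z w, le_rfl]
          · rfl
      have t3' := mul_nonneg (by positivity : 0 ≤ 2 * σ / s) t3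
      by_cases h1 : 2 * σ ≤ hardy f a y
      · have h := le_sum_below_truncated (hardy₁_nonneg hf a) (hf₁ a)
          (by linarith : δ ≤ σ) hb (by rwa [← hardy_eq_sum_hardy₁]) (by rwa [← hardy_eq_sum_hardy₁])
        simp only [← hardy_eq_sum_hardy₁] at h
        simp only [cut] at t1 t2 ⊢
        linarith
      by_cases h2 : 2 * σ ≤ hardy f x b
      · have h := le_sum_below_truncated (hardy₂_nonneg hf · b) (hf₂ · b)
          (by linarith : δ ≤ σ) ha (by rwa [← hardy_eq_sum_hardy₂]) (by rwa [← hardy_eq_sum_hardy₂])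
        simp only [← hardy_eq_sum_hardy₂] at h
        replace h : σ ≤ ∑ z ∈ pre x,
          if a <+: z then cut (hardy f) (hardy₂ f) (3 * σ) z b else 0 := h
        linarith
      · have h := hardy_le_add_add hf ha hb
        have h3 : s / 2 ≤ ∑ z ∈ pre x, if a <+: z then
          (∑ w ∈ pre y, if b <+: w then f z w else 0) else 0 := by linarith
        have h4 := mul_le_mul_of_nonneg_left h3 (by positivity : 0 ≤ 2 * σ / s)
        have h5 : 2 * σ / s * (s / 2) = σ := by field_simp
        linarith
    · simp [hpdef, cut, hab]
  have total := sum_le_sum fun a ha => sum_le_sum (point a ha)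
  simp only [sum_add_distrib, ← mul_sum, ← sum_mul] at total
  rw [sum_mul_sum_below] at total
  have e1 : ∑ a ∈ pre x, ∑ b ∈ pre y, p a b *
      (∑ w ∈ pre y, if b <+: w then cut (hardy f) (hardy₁ f) (3 * σ) a w else 0) =
      hardy (cut (hardy f) (fun a b => hardy₁ f a b * hardy₂ p a b) (3 * σ)) x y := by
    refine sum_congr rfl fun a _ => ?_
    rw [sum_pre_mul_sum_pre]
    refine sum_congr rfl fun w _ => ?_
    unfold cut
    split_ifs
    · rfl
    · simp
  have e2 : ∑ a ∈ pre x, ∑ b ∈ pre y, p a b *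
      (∑ z ∈ pre x, if a <+: z then cut (hardy f) (hardy₂ f) (3 * σ) z b else 0) =
      hardy (cut (hardy f) (fun a b => hardy₂ f a b * hardy₁ p a b) (3 * σ)) x y := by
    rw [sum_comm, hardy_eq_sum_hardy₁]
    refine sum_congr rfl fun b _ => ?_
    rw [sum_pre_mul_sum_pre (fun a => p a b) (fun z => cut (hardy f) (hardy₂ f) (3 * σ) z b)]
    refine sum_congr rfl fun z _ => ?_
    unfold cut
    split_ifs
    · rfl
    · simp
  have e3 : hardy (cut (hardy f) (cross f p) (3 * σ)) x y =
      hardy (cut (hardy f) (fun a b => hardy₁ f a b * hardy₂ p a b) (3 * σ)) x y +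
      hardy (cut (hardy f) (fun a b => hardy₂ f a b * hardy₁ p a b) (3 * σ)) x y := by
    simp only [hardy, ← sum_add_distrib]
    refine sum_congr rfl fun a _ => sum_congr rfl fun b _ => ?_
    simp only [cut, cross]
    split_ifs <;> simp
  have e4 : ∑ z ∈ pre x, ∑ w ∈ pre y, f z w * hardy p z w ≤ s * δ := by
    rw [hs, hardy, sum_mul]
    refine sum_le_sum fun z _ => ?_
    rw [sum_mul]
    exact sum_le_sum fun w _ =>
      (mul_le_mul_of_nonneg_left (hardy_le_hardy hpg z w) (hf z w)).trans (hfV z w)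
  have e5 := mul_le_mul_of_nonneg_left e4 (by positivity : 0 ≤ 2 * σ / s)
  have e6 : 2 * σ / s * (s * δ) = 2 * σ * δ := by field_simp
  rw [e1, e2] at total
  rw [e3]
  change hardy p x y * σ ≤ _ at total
  nlinarith

/-- The adjoint `𝕀*` of the Hardy operator, for functions in curried form. -/
def istar (N : ℕ) (ν : List Bool → List Bool → ℝ) (a b : List Bool) : ℝ :=
  ∑ x ∈ strings N, ∑ y ∈ strings N, if a <+: x then (if b <+: y then ν x y else 0) else 0

variable {ν μ : List Bool → List Bool → ℝ}

theorem istar_nonneg (hν : ∀ a b, 0 ≤ ν a b) (a b : List Bool) : 0 ≤ istar N ν a b :=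
  sum_nonneg fun x _ => sum_nonneg fun y _ => by
    split_ifs
    exacts [hν x y, le_rfl, le_rfl]

theorem istar_le_istar (h : ∀ a b, μ a b ≤ ν a b) (a b : List Bool) :
    istar N μ a b ≤ istar N ν a b :=
  sum_le_sum fun x _ => sum_le_sum fun y _ => by
    split_ifs
    exacts [h x y, le_rfl, le_rfl]

theorem superadd_sum_below {φ : List Bool → ℝ} (hφ : ∀ a, 0 ≤ φ a) :
    Superadd N fun a => ∑ x ∈ strings N, if a <+: x then φ x else 0 := by
  intro a ha
  simp only
  rw [sum_below_split φ ha.le]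
  linarith [hφ a]

theorem isSuper_istar (hν : ∀ a b, 0 ≤ ν a b) : IsSuper N (istar N ν) where
  nonneg := istar_nonneg hν
  left b := by
    have := superadd_sum_below (N := N)
      (φ := fun x => ∑ y ∈ strings N, if b <+: y then ν x y else 0)
      fun x => sum_nonneg fun y _ => by split_ifs; exacts [hν x y, le_rfl]
    convert this using 2 with a
    refine sum_congr rfl fun x _ => ?_
    split_ifs <;> simp
  right a := by
    have := superadd_sum_below (N := N)
      (φ := fun y => ∑ x ∈ strings N, if a <+: x then ν x y else 0)
      fun y => sum_nonneg fun x _ => by split_ifs; exacts [hν x y, le_rfl]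
    convert this using 2 with b
    rw [istar, sum_comm]
    refine sum_congr rfl fun y _ => ?_
    split_ifs <;> simp

theorem sum_mul_hardy (ν q : List Bool → List Bool → ℝ) :
    ∑ x ∈ strings N, ∑ y ∈ strings N, ν x y * hardy q x y =
      ∑ a ∈ strings N, ∑ b ∈ strings N, q a b * istar N ν a b := by
  have h : ∀ x ∈ strings N, ∀ y ∈ strings N, ν x y * hardy q x y =
      ∑ a ∈ strings N, ∑ b ∈ strings N,
        q a b * if a <+: x then (if b <+: y then ν x y else 0) else 0 := by
    intro x hx y hy
    rw [hardy, sum_pre_eq hx, mul_sum]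
    refine sum_congr rfl fun a _ => ?_
    split_ifs
    · rw [sum_pre_eq hy, mul_sum]
      refine sum_congr rfl fun b _ => ?_
      split_ifs <;> ring
    · simp
  rw [sum_congr rfl fun x hx => sum_congr rfl (h x hx)]
  simp only [istar, mul_sum]
  calc _ = ∑ x ∈ strings N, ∑ a ∈ strings N, ∑ y ∈ strings N, ∑ b ∈ strings N,
        q a b * (if a <+: x then (if b <+: y then ν x y else 0) else 0) :=
        sum_congr rfl fun x _ => sum_comm
    _ = ∑ a ∈ strings N, ∑ x ∈ strings N, ∑ b ∈ strings N, ∑ y ∈ strings N,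
        q a b * (if a <+: x then (if b <+: y then ν x y else 0) else 0) := by
        rw [sum_comm]
        exact sum_congr rfl fun a _ => sum_congr rfl fun x _ => sum_comm
    _ = _ := sum_congr rfl fun a _ => sum_comm

/-- Estimate for the part of the measure on which the truncated potentials live on prescribed
scales. -/
theorem sq_mul_sq_mass_le (hν : ∀ a b, 0 ≤ ν a b) (hμ : ∀ a b, 0 ≤ μ a b)
    (hμν : ∀ a b, μ a b ≤ ν a b) (hg : g = istar N ν) {δ σ X : ℝ} (hδ : 0 < δ)
    (hσ : 5 * δ ≤ σ) (hX : 0 < X) (R : List Bool → List Bool → ℝ)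
    (hf : f = cut (hardy g) g δ)
    (h1 : ∀ x y, μ x y ≠ 0 → 8 * σ ≤ hardy f x y)
    (h2 : ∀ x y, μ x y ≠ 0 → X ≤ hardy (cut (hardy f) g σ) x y)
    (h3 : ∀ x y, μ x y ≠ 0 → hardy (cut (hardy f) g σ) x y ≤ 2 * X)
    (h4 : ∀ x y, μ x y ≠ 0 → hardy (cut (hardy f) g (3 * σ)) x y ≤ 2 * X * R x y) :
    σ ^ 2 * (∑ x ∈ strings N, ∑ y ∈ strings N, μ x y) ^ 2 ≤
      256 * δ * (∑ a ∈ strings N, ∑ b ∈ strings N, f a b ^ 2) *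
        ∑ x ∈ strings N, ∑ y ∈ strings N, μ x y * R x y := by
  have hgS : IsSuper N g := hg ▸ isSuper_istar hν
  have hf0 : ∀ a b, 0 ≤ f a b := hf ▸ cut_nonneg hgS.nonneg δ
  set p := cut (hardy f) g σ with hp
  have hpS : IsSuper N p := hgS.cut_hardy hf0 σ
  set h := cut (hardy p) (cut (hardy f) (cross f p) (3 * σ)) (2 * X) with hh
  set m := ∑ x ∈ strings N, ∑ y ∈ strings N, μ x y with hm
  set S := ∑ a ∈ strings N, ∑ b ∈ strings N, f a b ^ 2 with hS
  set Q := ∑ a ∈ strings N, ∑ b ∈ strings N, h a b * istar N μ a b with hQ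
  have hσ0 : 0 < σ := by linarith
  have hm0 : 0 ≤ m := sum_nonneg fun _ _ => sum_nonneg fun _ _ => hμ _ _
  have lower : σ / 2 * X * m ≤ Q := by
    rw [hQ, ← sum_mul_hardy, hm, mul_sum]
    refine sum_le_sum fun x _ => ?_
    rw [mul_sum]
    refine sum_le_sum fun y _ => ?_
    rw [mul_comm]
    by_cases hxy : μ x y = 0
    · simp [hxy]
    refine mul_le_mul_of_nonneg_left ?_ (hμ x y)
    have := mul_hardy_cut_le_hardy_cross hgS.nonneg hδ hσ (hf ▸ h1 x y hxy)
    rw [← hf, ← hp] at this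
    have e : hardy h x y = hardy (cut (hardy f) (cross f p) (3 * σ)) x y :=
      sum_congr rfl fun z hz => sum_congr rfl fun w hw => if_pos
        ((hardy_mono hpS.nonneg (mem_pre.1 hz) (mem_pre.1 hw)).trans (h3 x y hxy))
    rw [e]
    exact (mul_le_mul_of_nonneg_left (h2 x y hxy) (by positivity)).trans this
  have upper₁ : (∑ a ∈ strings N, ∑ b ∈ strings N,
      if hardy p a b ≤ 2 * X then cross f p a b ^ 2 else 0) ≤ 32 * X * δ * S := by
    have := sum_sq_cross_le hgS hpS (cut_le hgS.nonneg σ) hδ.le (by positivity : 0 ≤ 2 * X)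
    rw [← hf] at this
    exact this.trans (le_of_eq (by ring))
  have upper₂ : (∑ a ∈ strings N, ∑ b ∈ strings N,
      cut (hardy f) g (3 * σ) a b * istar N μ a b) ≤
      2 * X * ∑ x ∈ strings N, ∑ y ∈ strings N, μ x y * R x y := by
    rw [← sum_mul_hardy, mul_sum]
    refine sum_le_sum fun x _ => ?_
    rw [mul_sum]
    refine sum_le_sum fun y _ => ?_
    by_cases hxy : μ x y = 0
    · simp [hxy]
    · have := mul_le_mul_of_nonneg_left (h4 x y hxy) (hμ x y)
      linarith
  have cs : Q ^ 2 ≤ (∑ a ∈ strings N, ∑ b ∈ strings N,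
      if hardy p a b ≤ 2 * X then cross f p a b ^ 2 else 0) *
      ∑ a ∈ strings N, ∑ b ∈ strings N, cut (hardy f) g (3 * σ) a b * istar N μ a b := by
    rw [hQ]
    simp only [← sum_product']
    refine sum_sq_le_sum_mul_sum_of_sq_le_mul _
      (fun _ _ => by split_ifs; exacts [sq_nonneg _, le_rfl])
      (fun _ _ => mul_nonneg (cut_nonneg hgS.nonneg _ _ _) (istar_nonneg hμ _ _))
      fun q _ => ?_
    have i0 : 0 ≤ istar N μ q.1 q.2 := istar_nonneg hμ _ _
    have i1 : istar N μ q.1 q.2 ≤ g q.1 q.2 := hg ▸ istar_le_istar hμν _ _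
    simp only [hh, cut]
    split_ifs
    · rw [mul_pow]
      refine mul_le_mul_of_nonneg_left ?_ (sq_nonneg _)
      nlinarith
    · simp
    · simp
    · simp
  have hS0 : 0 ≤ S := sum_nonneg fun _ _ => sum_nonneg fun _ _ => sq_nonneg _
  have u0 : 0 ≤ ∑ a ∈ strings N, ∑ b ∈ strings N,
      cut (hardy f) g (3 * σ) a b * istar N μ a b :=
    sum_nonneg fun _ _ => sum_nonneg fun _ _ =>
      mul_nonneg (cut_nonneg hgS.nonneg _ _ _) (istar_nonneg hμ _ _)
  have fin := cs.trans (mul_le_mul upper₁ upper₂ u0 (by positivity))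
  have low2 := pow_le_pow_left₀ (by positivity) lower 2
  set I := ∑ x ∈ strings N, ∑ y ∈ strings N, μ x y * R x y
  have : X ^ 2 * (σ ^ 2 * m ^ 2) ≤ X ^ 2 * (256 * δ * S * I) := by nlinarith
  exact le_of_mul_le_mul_left this (by positivity)

/-- Pigeonholing: away from the set where the truncated potential is small, there is a scale at
which the truncated potentials do not grow much. -/
theorem exists_scale (hgS : ∀ a b, 0 ≤ g a b) {δ : ℝ} (hδ : 0 < δ)
    (hf : f = cut (hardy g) g δ) (J : ℕ) {x y : List Bool} {ρ : ℝ} (hρ : 0 ≤ ρ)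
    (hρJ : ρ ^ J = hardy g x y / δ) (hF : 8 * 3 ^ (J + 2) * δ < hardy f x y) :
    ∃ k : ℕ × ℕ, 5 * δ ≤ 3 ^ k.1 * δ ∧ 8 * (3 ^ k.1 * δ) ≤ hardy f x y ∧
      hardy f x y ≤ 8 * 3 ^ (J + 1) * (3 ^ k.1 * δ) ∧
      2 ^ k.2 * δ ≤ hardy (cut (hardy f) g (3 ^ k.1 * δ)) x y ∧
      hardy (cut (hardy f) g (3 ^ k.1 * δ)) x y ≤ 2 * (2 ^ k.2 * δ) ∧
      hardy (cut (hardy f) g (3 * (3 ^ k.1 * δ))) x y ≤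
        ρ * hardy (cut (hardy f) g (3 ^ k.1 * δ)) x y ∧
      3 ^ k.1 * δ ≤ hardy g x y ∧ 2 ^ k.2 * δ ≤ hardy g x y := by
  have hFV : hardy f x y ≤ hardy g x y := hf ▸ hardy_le_hardy (cut_le hgS δ) x y
  set s := hardy f x y with hs
  set G : ℕ → ℝ := fun i => hardy (cut (hardy f) g (3 ^ i * δ)) x y with hG
  have hGV : ∀ i, G i ≤ hardy g x y := fun i => hardy_le_hardy (cut_le hgS _) x y
  have big : (3 : ℝ) ^ (J + 2) < s / (8 * δ) := by
    rw [lt_div_iff₀ (by positivity)]; linarith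
  obtain ⟨n, hn1, hn2⟩ := exists_nat_pow_near (x := s / (8 * δ)) (y := (3 : ℝ))
    ((one_le_pow₀ (by norm_num)).trans big.le) (by norm_num)
  rw [le_div_iff₀ (by positivity)] at hn1
  rw [div_lt_iff₀ (by positivity)] at hn2
  have hJn : J + 2 < n + 1 := by
    have := big.trans_le ((div_le_iff₀ (by positivity)).2 hn2.le)
    exact (pow_lt_pow_iff_right₀ (by norm_num : (1 : ℝ) < 3)).1 this
  have hpow : ∀ {i j : ℕ}, i ≤ j → (3 : ℝ) ^ i * δ ≤ 3 ^ j * δ := fun h =>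
    mul_le_mul_of_nonneg_right (pow_le_pow_right₀ (by norm_num) h) hδ.le
  have hσ : ∀ i, i ≤ n → 8 * (3 ^ i * δ) ≤ s := fun i hi => by
    have := hpow hi
    linarith
  have h9 : ∀ i, 2 ≤ i → 9 * δ ≤ 3 ^ i * δ := fun i hi => by
    have := hpow hi
    linarith
  have hG8 : ∀ i, 2 ≤ i → i ≤ n → 8 * δ ≤ G i := fun i hi hin => by
    have h1 := h9 i hi
    have h2 := hσ i hin
    have h3 := sub_le_hardy_cut (x := x) (y := y) (σ := 3 ^ i * δ) hgS hδ.le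
      (by rw [← hf]; linarith)
    rw [← hf] at h3
    change _ ≤ G i at h3
    linarith
  have exi : ∃ i, n - J ≤ i ∧ i < n ∧ G (i + 1) ≤ ρ * G i := by
    by_contra! hcon
    have step : ∀ k, k ≤ J → ρ ^ k * G (n - J) ≤ G (n - J + k) := by
      intro k
      induction k with
      | zero => simp
      | succ k ih =>
        intro hk
        have h1 := ih (by omega)
        have h2 := hcon (n - J + k) (by omega) (by omega)
        have h3 := mul_le_mul_of_nonneg_left h1 hρ
        rw [pow_succ, ← add_assoc]
        linarith
    have h1 := step J le_rfl
    rw [hρJ] at h1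
    have h2 := hG8 (n - J) (by omega) (by omega)
    have h3 := hGV (n - J + J)
    have hVpos : 0 < hardy g x y := by
      have : 0 < 8 * 3 ^ (J + 2) * δ := by positivity
      linarith
    have h4 := mul_le_mul_of_nonneg_left h2 (by positivity : 0 ≤ hardy g x y / δ)
    have h5 : hardy g x y / δ * (8 * δ) = 8 * hardy g x y := by field_simp
    linarith
  obtain ⟨i, hi1, hi2, hi3⟩ := exi
  have hGi := hG8 i (by omega) hi2.le
  obtain ⟨m, hm1, hm2⟩ := exists_nat_pow_near (x := G i / δ) (y := (2 : ℝ))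
    (by rw [le_div_iff₀ hδ]; linarith) (by norm_num)
  rw [le_div_iff₀ hδ] at hm1
  rw [div_lt_iff₀ hδ] at hm2
  refine ⟨(i, m), ?_, hσ i hi2.le, ?_, hm1, ?_, ?_, ?_, hm1.trans (hGV i)⟩
  · linarith [h9 i (by omega)]
  · have h1 := hpow (show n + 1 ≤ J + 1 + i by omega)
    rw [pow_add 3 (J + 1) i] at h1
    dsimp only
    linarith
  · change G i ≤ _
    rw [pow_succ] at hm2
    dsimp only
    linarith
  · have : (3 : ℝ) * (3 ^ i * δ) = 3 ^ (i + 1) * δ := by ring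
    dsimp only
    rw [this]
    exact hi3
  · have := hσ i hi2.le
    have : 0 < (3 : ℝ) ^ i * δ := by positivity
    dsimp only
    linarith

theorem sum_range_pow_le {r : ℝ} (hr0 : 0 ≤ r) {J : ℕ} (hJ : 0 < J) (hr : r ^ J = 1 / 2) (n : ℕ) :
    ∑ i ∈ range n, r ^ i ≤ 2 * J := by
  have hJ1 : (1 : ℝ) ≤ J := by exact_mod_cast hJ
  have hle : r ≤ 1 + -(1 / (2 * J)) := by
    by_contra! h
    have h0 : (1 : ℝ) / (2 * J) ≤ 1 := by rw [div_le_one (by positivity)]; linarith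
    have h1 := one_add_mul_le_pow (a := -(1 / (2 * (J : ℝ)))) (by linarith) J
    have h2 := pow_lt_pow_left₀ h (by linarith) hJ.ne'
    have h3 : 1 + (J : ℝ) * -(1 / (2 * J)) = 1 / 2 := by field_simp; norm_num
    linarith
  have hpos : (0 : ℝ) < 1 / (2 * J) := by positivity
  have h1 : (∑ i ∈ range n, r ^ i) * (1 - r) ≤ 1 := by
    rw [geom_sum_mul_neg]
    linarith [pow_nonneg hr0 n]
  have h2 : 0 ≤ ∑ i ∈ range n, r ^ i := sum_nonneg fun i _ => pow_nonneg hr0 i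
  have h3 : (∑ i ∈ range n, r ^ i) * (1 / (2 * J)) ≤ 1 :=
    (mul_le_mul_of_nonneg_left (by linarith) h2).trans h1
  rwa [mul_one_div, div_le_one (by positivity)] at h3

theorem sum_pow_mul_pow_le {r : ℝ} (hr0 : 0 ≤ r) {J : ℕ} (hJ : 0 < J) (hr : r ^ J = 1 / 2)
    (K : Finset (ℕ × ℕ)) : ∑ k ∈ K, r ^ k.1 * r ^ k.2 ≤ 4 * J ^ 2 := by
  obtain ⟨n, hn⟩ : ∃ n, K ⊆ range n ×ˢ range n := by
    refine ⟨K.sup (fun k => max k.1 k.2) + 1, fun k hk => ?_⟩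
    have := le_sup (f := fun k : ℕ × ℕ => max k.1 k.2) hk
    simp only [mem_product, mem_range]
    omega
  refine (sum_le_sum_of_subset_of_nonneg hn fun k _ _ => by positivity).trans ?_
  rw [sum_product, ← sum_mul_sum]
  have h1 := sum_range_pow_le hr0 hJ hr n
  have h2 : 0 ≤ ∑ i ∈ range n, r ^ i := sum_nonneg fun i _ => pow_nonneg hr0 i
  nlinarith

/-- The surrogate maximum principle with a free parameter `J`. -/
theorem sum_sq_cut_le (hν : ∀ a b, 0 ≤ ν a b) (hg : g = istar N ν) {δ A a : ℝ} (hδ : 0 < δ)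
    {J : ℕ} (hJ : 3 ≤ J) (ha : 1 ≤ a) (haJ : a ^ J = A)
    (hm : 0 < ∑ x ∈ strings N, ∑ y ∈ strings N, ν x y)
    (hE : ∑ x ∈ strings N, ∑ y ∈ strings N, g x y ^ 2 =
      A * (δ * ∑ x ∈ strings N, ∑ y ∈ strings N, ν x y)) :
    ∑ x ∈ strings N, ∑ y ∈ strings N, cut (hardy g) g δ x y ^ 2 ≤
      4718592 * 9 ^ J * J ^ 2 * a ^ 3 * (δ * ∑ x ∈ strings N, ∑ y ∈ strings N, ν x y) := by
  have hg0 : ∀ a b, 0 ≤ g a b := hg ▸ istar_nonneg hν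
  have hA : 0 < A := haJ ▸ pow_pos (by linarith) J
  have hJ0 : J ≠ 0 := by omega
  have hJ1 : (1 : ℝ) ≤ J := by exact_mod_cast (by omega : 1 ≤ J)
  set f := cut (hardy g) g δ with hf
  set M := ∑ x ∈ strings N, ∑ y ∈ strings N, ν x y with hM
  set S := ∑ x ∈ strings N, ∑ y ∈ strings N, f x y ^ 2 with hS
  have hS0 : 0 ≤ S := sum_nonneg fun _ _ => sum_nonneg fun _ _ => sq_nonneg _
  have hSν : S = ∑ x ∈ strings N, ∑ y ∈ strings N, ν x y * hardy f x y := by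
    rw [sum_mul_hardy, ← hg, hS]
    refine sum_congr rfl fun x _ => sum_congr rfl fun y _ => ?_
    rw [hf, cut]
    split_ifs <;> simp [sq]
  have hEν : A * (δ * M) = ∑ x ∈ strings N, ∑ y ∈ strings N, ν x y * hardy g x y := by
    rw [sum_mul_hardy, ← hg, ← hE]
    simp only [sq]
  have hf0 : ∀ a b, 0 ≤ f a b := cut_nonneg hg0 δ
  have hV0 : ∀ x y, 0 ≤ hardy g x y := hardy_nonneg hg0
  have exρ : ∀ t : ℝ, 0 ≤ t → ∃ ρ : ℝ, 0 ≤ ρ ∧ ρ ^ J = t := fun t ht =>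
    ⟨t ^ (J⁻¹ : ℝ), by positivity, Real.rpow_inv_natCast_pow ht hJ0⟩
  choose ρ hρ0 hρJ using fun x y => exρ (hardy g x y / δ) (div_nonneg (hV0 x y) hδ.le)
  obtain ⟨r, hr0, hrJ⟩ := exρ (1 / 2) (by norm_num)
  have hrpos : 0 < r := lt_of_le_of_ne hr0 fun h => by
    rw [← h, zero_pow hJ0] at hrJ
    norm_num at hrJ
  have exk : ∀ x y, ∃ k : ℕ × ℕ, 8 * 3 ^ (J + 2) * δ < hardy f x y → _ := fun x y => by
    by_cases h : 8 * 3 ^ (J + 2) * δ < hardy f x y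
    · obtain ⟨k, hk⟩ := exists_scale hg0 hδ hf J (hρ0 x y) (hρJ x y) h
      exact ⟨k, fun _ => hk⟩
    · exact ⟨(0, 0), fun h' => absurd h' h⟩
  choose k hk using exk
  set B := (strings N ×ˢ strings N).filter fun q => 8 * 3 ^ (J + 2) * δ < hardy f q.1 q.2 with hB
  set Z := ∑ q ∈ B, ν q.1 q.2 * hardy f q.1 q.2 with hZ
  have split : S ≤ 8 * 3 ^ (J + 2) * (δ * M) + Z := by
    rw [hSν, hZ, hB, sum_filter, hM, ← sum_product', ← sum_product', mul_sum, mul_sum,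
      ← sum_add_distrib]
    refine sum_le_sum fun q _ => ?_
    have := hν q.1 q.2
    split_ifs with h
    · have : 0 ≤ 8 * (3 : ℝ) ^ (J + 2) * (δ * ν q.1 q.2) := by positivity
      linarith
    · push Not at h
      have := mul_le_mul_of_nonneg_left h this
      linarith
  set D := (8 * 3 ^ (J + 1)) ^ 2 * (256 * δ * S) with hD
  have hD0 : 0 ≤ D := by positivity
  have fiber : ∀ c, (∑ q ∈ B with k q.1 q.2 = c, ν q.1 q.2 * hardy f q.1 q.2) ^ 2 ≤
      (r ^ c.1 * r ^ c.2) * ∑ q ∈ B with k q.1 q.2 = c, D * (ν q.1 q.2 * ρ q.1 q.2 ^ 3) := by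
    intro c
    set μ : List Bool → List Bool → ℝ := fun x y =>
      if 8 * 3 ^ (J + 2) * δ < hardy f x y ∧ k x y = c then ν x y else 0 with hμ
    have hμne : ∀ x y, μ x y ≠ 0 → 8 * 3 ^ (J + 2) * δ < hardy f x y ∧ k x y = c := by
      intro x y h
      by_contra h'
      exact h (if_neg h')
    have sumμ : ∀ φ : List Bool → List Bool → ℝ,
        ∑ x ∈ strings N, ∑ y ∈ strings N, μ x y * φ x y =
          ∑ q ∈ B with k q.1 q.2 = c, ν q.1 q.2 * φ q.1 q.2 := by
      intro φ
      rw [← sum_product', hB, filter_filter, sum_filter]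
      refine sum_congr rfl fun q _ => ?_
      simp only [hμ]
      split_ifs <;> simp
    have sumμ1 : ∑ x ∈ strings N, ∑ y ∈ strings N, μ x y =
        ∑ q ∈ B with k q.1 q.2 = c, ν q.1 q.2 := by
      simpa using sumμ fun _ _ => 1
    rcases (filter (fun q => k q.1 q.2 = c) B).eq_empty_or_nonempty with he | ⟨q₀, hq₀⟩
    · simp [he]
    obtain ⟨hq₀B, hq₀c⟩ := mem_filter.1 hq₀
    have h5 := (hk q₀.1 q₀.2 (mem_filter.1 hq₀B).2).1
    rw [hq₀c] at h5
    have main := sq_mul_sq_mass_le (N := N) (μ := μ) (X := 2 ^ c.2 * δ) hν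
      (fun x y => by simp only [hμ]; split_ifs; exacts [hν x y, le_rfl])
      (fun x y => by simp only [hμ]; split_ifs; exacts [le_rfl, hν x y]) hg hδ h5
      (by positivity) ρ hf
      (fun x y h => by obtain ⟨h1, rfl⟩ := hμne x y h; exact (hk x y h1).2.1)
      (fun x y h => by obtain ⟨h1, rfl⟩ := hμne x y h; exact (hk x y h1).2.2.2.1)
      (fun x y h => by obtain ⟨h1, rfl⟩ := hμne x y h; exact (hk x y h1).2.2.2.2.1)
      (fun x y h => by
        obtain ⟨h1, rfl⟩ := hμne x y h
        obtain ⟨-, -, -, -, h6, h7, -⟩ := hk x y h1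
        refine h7.trans ?_
        rw [mul_comm]
        exact mul_le_mul_of_nonneg_right h6 (hρ0 x y))
    rw [sumμ, sumμ1] at main
    have z1 : (∑ q ∈ B with k q.1 q.2 = c, ν q.1 q.2 * hardy f q.1 q.2) ≤
        8 * 3 ^ (J + 1) * (3 ^ c.1 * δ * ∑ q ∈ B with k q.1 q.2 = c, ν q.1 q.2) := by
      rw [mul_sum, mul_sum]
      refine sum_le_sum fun q hq => ?_
      obtain ⟨hqB, hqc⟩ := mem_filter.1 hq
      have h3 := (hk q.1 q.2 (mem_filter.1 hqB).2).2.2.1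
      rw [hqc] at h3
      have := mul_le_mul_of_nonneg_left h3 (hν q.1 q.2)
      linarith
    have z0 : 0 ≤ ∑ q ∈ B with k q.1 q.2 = c, ν q.1 q.2 * hardy f q.1 q.2 :=
      sum_nonneg fun q _ => mul_nonneg (hν _ _) (hardy_nonneg hf0 _ _)
    have z2 := pow_le_pow_left₀ z0 z1 2
    rw [mul_pow, mul_pow _ (∑ q ∈ B with k q.1 q.2 = c, ν q.1 q.2) 2] at z2
    refine z2.trans ((mul_le_mul_of_nonneg_left main (by positivity)).trans ?_)
    rw [← mul_assoc, ← hD, mul_sum, mul_sum]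
    refine sum_le_sum fun q hq => ?_
    obtain ⟨hqB, hqc⟩ := mem_filter.1 hq
    obtain ⟨-, -, -, -, -, -, h8, h9⟩ := hk q.1 q.2 (mem_filter.1 hqB).2
    rw [hqc] at h8 h9
    have key : ∀ n : ℕ, (2 : ℝ) ^ n * δ ≤ hardy g q.1 q.2 → 1 ≤ r ^ n * ρ q.1 q.2 := by
      intro n hn
      have h10 : (1 : ℝ) ^ J ≤ (r ^ n * ρ q.1 q.2) ^ J := by
        rw [one_pow, mul_pow, hρJ, ← pow_mul, mul_comm n J, pow_mul, hrJ, one_div, inv_pow,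
          inv_mul_eq_div, one_le_div (by positivity), le_div_iff₀ hδ]
        exact hn
      exact (pow_le_pow_iff_left₀ zero_le_one
        (mul_nonneg (by positivity) (hρ0 _ _)) hJ0).1 h10
    have k1 := key c.1 ((mul_le_mul_of_nonneg_right
      (pow_le_pow_left₀ (by norm_num) (by norm_num) _) hδ.le).trans h8)
    have k2 := key c.2 h9
    have k3 := one_le_mul_of_one_le_of_one_le k1 k2
    have k4 := mul_le_mul_of_nonneg_left k3
      (mul_nonneg hD0 (mul_nonneg (hν q.1 q.2) (hρ0 q.1 q.2)))
    linarith
  have hZsum : Z = ∑ c ∈ B.image fun q => k q.1 q.2,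
      ∑ q ∈ B with k q.1 q.2 = c, ν q.1 q.2 * hardy f q.1 q.2 :=
    (sum_fiberwise_of_maps_to (fun q hq => mem_image_of_mem _ hq) _).symm
  have hZ2 : Z ^ 2 ≤ (4 * J ^ 2) * ∑ q ∈ B, D * (ν q.1 q.2 * ρ q.1 q.2 ^ 3) := by
    have nn : ∀ q : List Bool × List Bool, 0 ≤ D * (ν q.1 q.2 * ρ q.1 q.2 ^ 3) := fun q =>
      mul_nonneg hD0 (mul_nonneg (hν _ _) (pow_nonneg (hρ0 _ _) 3))
    refine le_trans ?_ (mul_le_mul_of_nonneg_right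
      (sum_pow_mul_pow_le hr0 (by omega) hrJ (B.image fun q => k q.1 q.2))
      (sum_nonneg fun q _ => nn q))
    rw [hZsum, ← sum_fiberwise_of_maps_to (s := B) (t := B.image fun q => k q.1 q.2)
      (g := fun q => k q.1 q.2) (fun q hq => mem_image_of_mem _ hq)
      (fun q => D * (ν q.1 q.2 * ρ q.1 q.2 ^ 3))]
    exact sum_sq_le_sum_mul_sum_of_sq_le_mul _ (fun _ _ => by positivity)
      (fun _ _ => sum_nonneg fun q _ => nn q) fun c _ => fiber c
  have hρ3 : ∀ x y, ρ x y ^ 3 ≤ a ^ 3 * (1 + hardy g x y / (δ * A)) := by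
    intro x y
    have h0 : 0 ≤ hardy g x y / (δ * A) := div_nonneg (hV0 x y) (by positivity)
    have h1 : (ρ x y / a) ^ J = hardy g x y / (δ * A) := by
      rw [div_pow, hρJ, haJ, div_div]
    have h2 : (ρ x y / a) ^ 3 ≤ 1 + hardy g x y / (δ * A) := by
      rcases le_total (ρ x y / a) 1 with h | h
      · exact (pow_le_one₀ (div_nonneg (hρ0 x y) (by linarith)) h).trans (by linarith)
      · exact (pow_le_pow_right₀ h hJ).trans (by linarith)
    rw [div_pow, div_le_iff₀ (by positivity)] at h2
    linarith
  have hI : ∑ q ∈ B, D * (ν q.1 q.2 * ρ q.1 q.2 ^ 3) ≤ D * (2 * a ^ 3 * M) := by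
    rw [← mul_sum]
    refine mul_le_mul_of_nonneg_left ?_ hD0
    calc _ ≤ ∑ q ∈ strings N ×ˢ strings N, ν q.1 q.2 * ρ q.1 q.2 ^ 3 :=
          sum_le_sum_of_subset_of_nonneg (filter_subset _ _) fun q _ _ =>
            mul_nonneg (hν _ _) (pow_nonneg (hρ0 _ _) 3)
      _ ≤ ∑ q ∈ strings N ×ˢ strings N, (a ^ 3 * ν q.1 q.2 +
            a ^ 3 / (δ * A) * (ν q.1 q.2 * hardy g q.1 q.2)) := by
          refine sum_le_sum fun q _ => ?_
          refine (mul_le_mul_of_nonneg_left (hρ3 q.1 q.2) (hν q.1 q.2)).trans (le_of_eq ?_)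
          ring
      _ = a ^ 3 * M + a ^ 3 / (δ * A) * (A * (δ * M)) := by
          rw [hEν, hM, sum_add_distrib, ← mul_sum, ← mul_sum, sum_product, sum_product]
      _ = 2 * a ^ 3 * M := by
          field_simp
          ring
  have hZ3 := hZ2.trans (mul_le_mul_of_nonneg_left hI (by positivity))
  have ha3 : 1 ≤ a ^ 3 := one_le_pow₀ ha
  have h9 : (3 : ℝ) ^ J ≤ 9 ^ J := pow_le_pow_left₀ (by norm_num) (by norm_num) J
  have h33 : ((3 : ℝ) ^ J) ^ 2 = 9 ^ J := by rw [← pow_mul, mul_comm, pow_mul]; norm_num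
  have hδM : 0 < δ * M := by positivity
  by_contra! hcon
  set C := 4718592 * 9 ^ J * (J : ℝ) ^ 2 * a ^ 3 with hC
  have hC1 : 144 * (3 : ℝ) ^ J ≤ C := by
    have h1 : (1 : ℝ) ≤ J ^ 2 * a ^ 3 := one_le_mul_of_one_le_of_one_le (one_le_pow₀ hJ1) ha3
    have h2 := mul_le_mul_of_nonneg_left h1 (by positivity : (0 : ℝ) ≤ 4718592 * 9 ^ J)
    have h3 : (0 : ℝ) < 9 ^ J := by positivity
    linarith
  have hC2 := mul_le_mul_of_nonneg_right hC1 hδM.le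
  have hp2 : (3 : ℝ) ^ (J + 2) = 9 * 3 ^ J := by ring
  rw [hp2] at split
  have hZS : S / 2 ≤ Z := by linarith
  have hZS2 := pow_le_pow_left₀ (by positivity) hZS 2
  have hfin : 4 * (J : ℝ) ^ 2 * (D * (2 * a ^ 3 * M)) = C * (δ * M) * S / 4 := by
    rw [hD, hC, ← h33]
    ring
  rw [hfin] at hZ3
  have hSpos : 0 < S := lt_of_le_of_lt (by positivity) hcon
  have hlast := mul_lt_mul_of_pos_right hcon hSpos
  nlinarith

end TwoParameters

theorem const_le_exp {A : ℝ} (hA : 2 ≤ A) : ∃ (J : ℕ) (a : ℝ), 3 ≤ J ∧ 1 ≤ a ∧ a ^ J = A ∧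
    4718592 * 9 ^ J * (J : ℝ) ^ 2 * a ^ 3 ≤ Real.exp (50 * Real.sqrt (Real.log A)) := by
  have hL : 0.69 ≤ Real.log A :=
    (Real.log_two_gt_d9.le.trans' (by norm_num)).trans (Real.log_le_log (by norm_num) hA)
  set q := Real.sqrt (Real.log A) with hq
  have hq2 : q ^ 2 = Real.log A := Real.sq_sqrt (by linarith)
  have hq0 : 0.8 ≤ q := Real.le_sqrt_of_sq_le (by norm_num; linarith)
  have hJle : ((⌈q⌉₊ + 3 : ℕ) : ℝ) ≤ q + 4 := by
    have := (Nat.ceil_lt_add_one (by linarith : 0 ≤ q)).le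
    push_cast
    linarith
  have hJge : q ≤ ((⌈q⌉₊ + 3 : ℕ) : ℝ) := by
    have := Nat.le_ceil q
    push_cast
    linarith
  have hJ3 : 3 ≤ ⌈q⌉₊ + 3 := by omega
  generalize ⌈q⌉₊ + 3 = J at hJle hJge hJ3
  have hJ0 : (0 : ℝ) < J := by exact_mod_cast (by omega : 0 < J)
  refine ⟨J, Real.exp (Real.log A / J), hJ3, Real.one_le_exp (by positivity), ?_, ?_⟩
  · rw [← Real.exp_nat_mul, mul_div_cancel₀ _ hJ0.ne', Real.exp_log (by linarith)]
  have e1 : Real.exp (Real.log A / J) ^ 3 ≤ Real.exp (3 * q) := by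
    rw [← Real.exp_nat_mul]
    refine Real.exp_le_exp.2 ?_
    have : Real.log A / J ≤ q := by
      rw [div_le_iff₀ hJ0, ← hq2]
      nlinarith
    push_cast
    linarith
  have he : (2.7 : ℝ) ≤ Real.exp 1 := Real.exp_one_gt_d9.le.trans' (by norm_num)
  have e2 : (4718592 : ℝ) ≤ Real.exp 16 := by
    have h1 := pow_le_pow_left₀ (by norm_num) he 16
    rw [← Real.exp_nat_mul] at h1
    norm_num at h1 ⊢
    linarith
  have e3 : (9 : ℝ) ^ J * (J : ℝ) ^ 2 ≤ Real.exp (4 * q + 16) := by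
    have h1 : (J : ℝ) ≤ 2 ^ J := by exact_mod_cast J.lt_two_pow_self.le
    have h2 : (J : ℝ) ^ 2 ≤ 4 ^ J := by
      refine (pow_le_pow_left₀ hJ0.le h1 2).trans (le_of_eq ?_)
      rw [← pow_mul, mul_comm, pow_mul]
      norm_num
    have h3 : (36 : ℝ) ≤ Real.exp 4 := by
      have h1 := pow_le_pow_left₀ (by norm_num) he 4
      rw [← Real.exp_nat_mul] at h1
      norm_num at h1 ⊢
      linarith
    calc (9 : ℝ) ^ J * (J : ℝ) ^ 2 ≤ 9 ^ J * 4 ^ J :=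
          mul_le_mul_of_nonneg_left h2 (by positivity)
      _ = 36 ^ J := by rw [← mul_pow]; norm_num
      _ ≤ Real.exp 4 ^ J := pow_le_pow_left₀ (by norm_num) h3 J
      _ = Real.exp (J * 4) := (Real.exp_nat_mul 4 J).symm
      _ ≤ _ := Real.exp_le_exp.2 (by linarith)
  calc 4718592 * 9 ^ J * (J : ℝ) ^ 2 * Real.exp (Real.log A / J) ^ 3
      = 4718592 * (9 ^ J * (J : ℝ) ^ 2) * Real.exp (Real.log A / J) ^ 3 := by ring
    _ ≤ Real.exp 16 * Real.exp (4 * q + 16) * Real.exp (3 * q) := by gcongr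
    _ = Real.exp (7 * q + 32) := by
        rw [← Real.exp_add, ← Real.exp_add]
        ring_nf
    _ ≤ _ := Real.exp_le_exp.2 (by linarith)

theorem biI_eq {N : ℕ} (f : List Bool × List Bool → ℝ) {p : List Bool × List Bool}
    (hp : p ∈ biVertices N) : biI N f p = hardy (Function.curry f) p.1 p.2 := by
  obtain ⟨h1, h2⟩ := mem_product.1 hp
  rw [biI, biVertices, sum_filter, sum_product, hardy, sum_pre_eq h1]
  refine sum_congr rfl fun a _ => ?_
  split_ifs with h
  · rw [sum_pre_eq h2]
    exact sum_congr rfl fun b _ => by simp [h]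
  · exact sum_eq_zero fun b _ => by simp [h]

theorem biIstar_eq (N : ℕ) (ν : List Bool × List Bool → ℝ) (p : List Bool × List Bool) :
    biIstar N ν p = istar N (Function.curry ν) p.1 p.2 := by
  rw [biIstar, biVertices, sum_filter, sum_product, istar]
  refine sum_congr rfl fun a _ => sum_congr rfl fun b _ => ?_
  simp only [ite_and]
  rfl

theorem biV_eq {N : ℕ} (ν : List Bool × List Bool → ℝ) {p : List Bool × List Bool}
    (hp : p ∈ biVertices N) :
    biV N ν p = hardy (istar N (Function.curry ν)) p.1 p.2 := by
  rw [biV, biI_eq _ hp]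
  congr 1
  funext a b
  exact biIstar_eq N ν (a, b)

theorem biMass_eq (N : ℕ) (ν : List Bool × List Bool → ℝ) :
    biMass N ν = ∑ x ∈ strings N, ∑ y ∈ strings N, Function.curry ν x y :=
  sum_product _ _ _

theorem biEnergy_eq (N : ℕ) (ν : List Bool × List Bool → ℝ) :
    biEnergy N ν = ∑ x ∈ strings N, ∑ y ∈ strings N, istar N (Function.curry ν) x y ^ 2 := by
  simp only [biEnergy, biIstar_eq, biVertices, sum_product]

theorem biPartialEnergy_eq (N : ℕ) (ν : List Bool × List Bool → ℝ) (ε : ℝ) :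
    biPartialEnergy N ν ε = ∑ x ∈ strings N, ∑ y ∈ strings N,
      cut (hardy (istar N (Function.curry ν))) (istar N (Function.curry ν)) ε x y ^ 2 := by
  rw [biPartialEnergy, sum_filter, ← sum_product', ← biVertices]
  refine sum_congr rfl fun p hp => ?_
  rw [biV_eq ν hp, biIstar_eq, cut]
  split_ifs <;> simp

end BiTree

/-- **Surrogate maximum principle on the bi-tree** (Theorem `smp`). -/
theorem stmt7 : ∃ c₀ : ℝ, 0 < c₀ ∧ ∀ N : ℕ, 1 ≤ N →
    ∀ ν : List Bool × List Bool → ℝ, IsBiMeasureOnBoundary N ν → 0 < biMass N ν →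
    ∀ ε : ℝ, 0 < ε → 2 * ε * biMass N ν ≤ biEnergy N ν →
    biPartialEnergy N ν ε ≤
      ε * Real.exp (c₀ * Real.sqrt (Real.log (biEnergy N ν / (ε * biMass N ν)))) * biMass N ν := by
  refine ⟨50, by norm_num, fun N _ ν hν hm ε hε hE => ?_⟩
  have hεm : 0 < ε * biMass N ν := mul_pos hε hm
  obtain ⟨J, a, hJ, ha, haJ, hC⟩ := BiTree.const_le_exp
    (A := biEnergy N ν / (ε * biMass N ν)) (by rw [le_div_iff₀ hεm]; linarith)
  have hE' : biEnergy N ν = biEnergy N ν / (ε * biMass N ν) * (ε * biMass N ν) :=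
    (div_mul_cancel₀ _ hεm.ne').symm
  have main := BiTree.sum_sq_cut_le (N := N) (ν := Function.curry ν) (δ := ε)
    (A := biEnergy N ν / (ε * biMass N ν)) (fun x y => hν.1 (x, y)) rfl hε hJ ha haJ
    (by rwa [← BiTree.biMass_eq]) (by rwa [← BiTree.biMass_eq, ← BiTree.biEnergy_eq])
  rw [← BiTree.biPartialEnergy_eq, ← BiTree.biMass_eq] at main
  have := mul_le_mul_of_nonneg_right hC hεm.le
  linarith
end
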